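/- arXiv:2507.05242 — 4 statements merged into one kernel-verified Lean document; each statement's English description precedes it below -/
import Mathlib

section
/- (GBLP trace inequality, direct direction.) Let A and B be n×n complex positive semidefinite matrices. Then for all real numbers p, q, r with 0 < q ≤ p and r ≥ 0: Tr[A^{r+q} · B^q] ≤ Tr[A^r · (A^{p/2} B^p A^{p/2})^{q/p}]. (Both traces are real; equivalently the inequality holds between their real parts.) -/
open scoped ComplexOrder

/-- `mpow A s` is the matrix power `A ^ s` (for real `s`) defined via the continuous
functional calculus: if `A = Σ_i λ_i P_i` is a spectral decomposition, `mpow A s = Σ_i λ_i ^ s • P_i`. -/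
noncomputable def mpow {m : ℕ} (A : Matrix (Fin m) (Fin m) ℂ) (s : ℝ) :
    Matrix (Fin m) (Fin m) ℂ :=
  cfc (fun x : ℝ => x ^ s) A

/-- `mfun f A` is `f(A)` defined via the continuous functional calculus:
if `A = Σ_i λ_i P_i` is a spectral decomposition, `mfun f A = Σ_i f (λ_i) • P_i`. -/
noncomputable def mfun {m : ℕ} (f : ℝ → ℝ) (A : Matrix (Fin m) (Fin m) ℂ) :
    Matrix (Fin m) (Fin m) ℂ :=
  cfc f A

section core
open Matrix
open scoped Matrix.Norms.L2Operator

noncomputable def Sm {n : ℕ} (d : Fin n → ℝ) (K : Matrix (Fin n) (Fin n) ℂ) (s t : ℝ) :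
    Matrix (Fin n) (Fin n) ℂ :=
  diagonal (fun i => ((d i ^ s : ℝ) : ℂ)) + t • K

noncomputable def Rm {n : ℕ} (d : Fin n → ℝ) (K : Matrix (Fin n) (Fin n) ℂ) (s t : ℝ) :
    Matrix (Fin n) (Fin n) ℂ := (Sm d K s t)⁻¹

variable {n : ℕ} {d : Fin n → ℝ} {K : Matrix (Fin n) (Fin n) ℂ}

lemma Sm_posDef (hd : ∀ i, 0 < d i) (hK : K.PosDef) {s t : ℝ} (ht : 0 < t) :
    (Sm d K s t).PosDef := by
  unfold Sm
  refine Matrix.PosDef.add ?_ ?_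
  · rw [Matrix.posDef_diagonal_iff]
    intro i
    exact_mod_cast Real.rpow_pos_of_pos (hd i) s
  · exact hK.smul ht

lemma Rm_posDef (hd : ∀ i, 0 < d i) (hK : K.PosDef) {s t : ℝ} (ht : 0 < t) :
    (Rm d K s t).PosDef := (Sm_posDef hd hK ht).inv

lemma Sm_isUnit (hd : ∀ i, 0 < d i) (hK : K.PosDef) {s t : ℝ} (ht : 0 < t) :
    IsUnit (Sm d K s t) := (Sm_posDef hd hK ht).isUnit

lemma hasDerivAt_minv {S : ℝ → Matrix (Fin n) (Fin n) ℂ} {S' : Matrix (Fin n) (Fin n) ℂ} {x : ℝ}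
    (h : HasDerivAt S S' x) (hu : IsUnit (S x)) :
    HasDerivAt (fun y => (S y)⁻¹) (-((S x)⁻¹ * S' * (S x)⁻¹)) x := by
  obtain ⟨u, hu⟩ := hu
  have h1 := hasFDerivAt_ringInverse (𝕜 := ℝ) u
  rw [hu] at h1
  have h2 := h1.comp_hasDerivAt x h
  have : (fun y => (S y)⁻¹) = Ring.inverse ∘ S := by
    funext y; simp [Matrix.nonsing_inv_eq_ringInverse]
  rw [this]
  have h3 : ((u⁻¹ : (Matrix (Fin n) (Fin n) ℂ)ˣ) : Matrix (Fin n) (Fin n) ℂ) = (S x)⁻¹ := by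
    rw [← hu, Matrix.coe_units_inv]
  rw [h3] at h2
  exact h2

lemma hasDerivAt_entry {F : ℝ → Matrix (Fin n) (Fin n) ℂ} {F' : Matrix (Fin n) (Fin n) ℂ} {x : ℝ}
    (h : HasDerivAt F F' x) (i : Fin n) :
    HasDerivAt (fun y => (F y i i).re) ((F' i i).re) x := by
  let e : Matrix (Fin n) (Fin n) ℂ →L[ℝ] ℝ := LinearMap.toContinuousLinearMap
    (Complex.reLm.comp (Matrix.entryLinearMap ℝ ℂ i i))
  exact e.hasFDerivAt.comp_hasDerivAt x h

lemma hasDerivAt_of_entries {F : ℝ → Matrix (Fin n) (Fin n) ℂ} {F' : Matrix (Fin n) (Fin n) ℂ} {x : ℝ}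
    (h : ∀ i j, HasDerivAt (fun y => F y i j) (F' i j) x) : HasDerivAt F F' x := by
  let e : (Fin n → Fin n → ℂ) →L[ℝ] Matrix (Fin n) (Fin n) ℂ := LinearMap.toContinuousLinearMap
    (Matrix.ofLinearEquiv (R := ℝ)).toLinearMap
  have h0 : HasDerivAt (fun y => (fun i j => F y i j : Fin n → Fin n → ℂ)) (fun i j => F' i j) x := by
    rw [hasDerivAt_pi]; intro i
    rw [hasDerivAt_pi]; intro j; exact h i j
  exact e.hasFDerivAt.comp_hasDerivAt x h0

lemma Sm_deriv_s (hd : ∀ i, 0 < d i) (s t : ℝ) :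
    HasDerivAt (fun s => Sm d K s t)
      (diagonal (fun i => ((d i ^ s * Real.log (d i) : ℝ) : ℂ))) s := by
  apply hasDerivAt_of_entries
  intro i j
  unfold Sm
  simp only [Matrix.add_apply]
  apply HasDerivAt.add_const
  by_cases hij : i = j
  · subst hij
    simp only [diagonal_apply_eq]
    apply HasDerivAt.ofReal_comp
    have := (hasDerivAt_id s).const_rpow (hd i)
    simpa [mul_comm] using this
  · simp only [diagonal_apply_ne _ hij]
    exact hasDerivAt_const _ _

lemma Sm_deriv_t (s t : ℝ) :
    HasDerivAt (fun t => Sm d K s t) K t := by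
  unfold Sm
  simpa using ((hasDerivAt_id t).smul_const K).const_add (diagonal (fun i => ((d i ^ s : ℝ) : ℂ)))

lemma Sm_continuous (hd : ∀ i, 0 < d i) : Continuous (fun z : ℝ × ℝ => Sm d K z.1 z.2) := by
  unfold Sm
  refine Continuous.add ?_ (by fun_prop)
  refine Continuous.matrix_diagonal ?_
  refine continuous_pi fun i => Complex.continuous_ofReal.comp ?_
  exact Continuous.rpow continuous_const continuous_fst (fun z => Or.inl (hd i).ne')

lemma Rm_continuousOn (hd : ∀ i, 0 < d i) (hK : K.PosDef) :
    ContinuousOn (fun z : ℝ × ℝ => Rm d K z.1 z.2) {z | 0 < z.2} := by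
  intro z hz
  apply ContinuousAt.continuousWithinAt
  obtain ⟨u, hu⟩ := Sm_isUnit (s := z.1) hd hK hz
  have h1 := NormedRing.inverse_continuousAt u
  rw [hu] at h1
  have h2 := ContinuousAt.comp (f := fun z : ℝ × ℝ => Sm d K z.1 z.2) h1 (Sm_continuous hd).continuousAt
  unfold Rm
  simpa [Matrix.nonsing_inv_eq_ringInverse, Function.comp_def] using h2

lemma Rm_deriv_s (hd : ∀ i, 0 < d i) (hK : K.PosDef) {s t : ℝ} (ht : 0 < t) (i : Fin n) :
    HasDerivAt (fun s => (Rm d K s t i i).re)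
      (-∑ j, d j ^ s * Real.log (d j) * Complex.normSq (Rm d K s t i j)) s := by
  have h := hasDerivAt_entry (hasDerivAt_minv (Sm_deriv_s (K := K) hd s t) (Sm_isUnit hd hK ht)) i
  change HasDerivAt (fun s => (Rm d K s t i i).re) _ _ at h
  convert h using 1
  change _ = ((-(Rm d K s t * (diagonal (fun i => ((d i ^ s * Real.log (d i) : ℝ) : ℂ))) * Rm d K s t) : Matrix (Fin n) (Fin n) ℂ) i i).re
  have hH := (Rm_posDef (s := s) hd hK ht).isHermitian
  rw [Matrix.neg_apply, Matrix.mul_apply, Complex.neg_re, Complex.re_sum]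
  congr 1
  refine Finset.sum_congr rfl fun j _ => ?_
  rw [Matrix.mul_diagonal, ← hH.apply j i]
  rw [mul_right_comm _ _ (star _), Complex.star_def, Complex.mul_conj, ← Complex.ofReal_mul, Complex.ofReal_re]
  ring

lemma Rm_self (hd : ∀ i, 0 < d i) (hK : K.PosDef) {s t : ℝ} (ht : 0 < t) (i : Fin n) :
    (Rm d K s t i i).re = ∑ j, d j ^ s * Complex.normSq (Rm d K s t i j)
      + t * ((Rm d K s t * K * Rm d K s t) i i).re := by
  have hH := (Rm_posDef (s := s) hd hK ht).isHermitian
  have hu : Rm d K s t * Sm d K s t = 1 := by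
    unfold Rm
    exact Matrix.nonsing_inv_mul _ ((Matrix.isUnit_iff_isUnit_det _).1 (Sm_isUnit hd hK ht))
  have h : Rm d K s t = Rm d K s t * diagonal (fun i => ((d i ^ s : ℝ) : ℂ)) * Rm d K s t
      + t • (Rm d K s t * K * Rm d K s t) := by
    conv_lhs => rw [← one_mul (Rm d K s t), ← hu, Sm]
    simp [mul_add, add_mul]
  conv_lhs => rw [h]
  rw [Matrix.add_apply, Complex.add_re, Matrix.mul_apply, Complex.re_sum]
  congr 1
  · refine Finset.sum_congr rfl fun j _ => ?_
    rw [Matrix.mul_diagonal, ← hH.apply j i]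
    rw [mul_right_comm, Complex.star_def, Complex.mul_conj, ← Complex.ofReal_mul, Complex.ofReal_re]
    ring
  · simp

lemma Rm_deriv_t (hd : ∀ i, 0 < d i) (hK : K.PosDef) {s t : ℝ} (ht : 0 < t) (i : Fin n) :
    HasDerivAt (fun t => (Rm d K s t i i).re)
      (-(Rm d K s t * K * Rm d K s t) i i).re t := by
  have h := hasDerivAt_entry (hasDerivAt_minv (Sm_deriv_t (d := d) (K := K) s t) (Sm_isUnit hd hK ht)) i
  change HasDerivAt (fun t => (Rm d K s t i i).re) _ _ at h
  convert h using 1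
  simp [Rm]

lemma Rm_diag_pos (hd : ∀ i, 0 < d i) (hK : K.PosDef) {s t : ℝ} (ht : 0 < t) (i : Fin n) :
    0 < (Rm d K s t i i).re := by
  have := (Rm_posDef (s := s) hd hK ht).diag_pos (i := i)
  exact (Complex.lt_def.1 this).1

lemma Rm_le_normSq (i : Fin n) (s t : ℝ) :
    (Rm d K s t i i).re ^ 2 ≤ Complex.normSq (Rm d K s t i i) := by
  rw [Complex.normSq_apply]; nlinarith [sq_nonneg (Rm d K s t i i).im]

lemma RKR_nonneg (hd : ∀ i, 0 < d i) {K' : Matrix (Fin n) (Fin n) ℂ} (hK : K.PosDef) (hK' : K'.PosSemidef) {s t : ℝ} (ht : 0 < t) (i : Fin n) :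
    0 ≤ ((Rm d K s t * K' * Rm d K s t) i i).re := by
  have hH := (Rm_posDef (s := s) hd hK ht).isHermitian
  have := (hK'.mul_mul_conjTranspose_same (Rm d K s t)).diag_nonneg (i := i)
  rw [hH.eq] at this
  exact (Complex.le_def.1 this).1

lemma Rm_bound_d (hd : ∀ i, 0 < d i) (hK : K.PosDef) {s t : ℝ} (ht : 0 < t) (i : Fin n) :
    d i ^ s * (Rm d K s t i i).re ≤ 1 := by
  have h1 := Rm_self (s := s) hd hK ht i
  have h2 := RKR_nonneg (s := s) hd hK hK.posSemidef ht i
  have h3 := Rm_diag_pos (s := s) hd hK ht i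
  have h4 : d i ^ s * Complex.normSq (Rm d K s t i i) ≤ ∑ j, d j ^ s * Complex.normSq (Rm d K s t i j) :=
    Finset.single_le_sum (f := fun j => d j ^ s * Complex.normSq (Rm d K s t i j))
      (fun j _ => mul_nonneg (Real.rpow_pos_of_pos (hd j) s).le (Complex.normSq_nonneg _)) (Finset.mem_univ i)
  have h5 := mul_le_mul_of_nonneg_left (Rm_le_normSq (d := d) (K := K) i s t) (Real.rpow_pos_of_pos (hd i) s).le
  have h6 := mul_nonneg ht.le h2
  have h7 : (d i ^ s * (Rm d K s t i i).re) * (Rm d K s t i i).re ≤ 1 * (Rm d K s t i i).re := by nlinarith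
  exact le_of_mul_le_mul_right h7 h3

lemma exists_kappa (hK : K.PosDef) : ∃ κ : ℝ, 0 < κ ∧ (K - κ • (1 : Matrix (Fin n) (Fin n) ℂ)).PosSemidef := by
  obtain ⟨κ, hκ, h⟩ : ∃ κ : ℝ, 0 < κ ∧ ∀ i, κ ≤ hK.isHermitian.eigenvalues i := by
    rcases isEmpty_or_nonempty (Fin n) with he | he
    · exact ⟨1, one_pos, fun i => he.elim i⟩
    · obtain ⟨i, hi⟩ := Finite.exists_min hK.isHermitian.eigenvalues
      exact ⟨_, hK.eigenvalues_pos i, hi⟩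
  refine ⟨κ, hκ, ?_⟩
  have hs := hK.isHermitian.spectral_theorem
  rw [Unitary.conjStarAlgAut_apply] at hs
  set U := hK.isHermitian.eigenvectorUnitary
  have h2 : K - κ • (1 : Matrix (Fin n) (Fin n) ℂ) = (U : Matrix (Fin n) (Fin n) ℂ) *
      diagonal (fun i => ((hK.isHermitian.eigenvalues i - κ : ℝ) : ℂ)) * (U : Matrix (Fin n) (Fin n) ℂ)ᴴ := by
    have h3 : diagonal (fun i => ((hK.isHermitian.eigenvalues i - κ : ℝ) : ℂ)) =
      diagonal (RCLike.ofReal ∘ hK.isHermitian.eigenvalues) - κ • (1 : Matrix (Fin n) (Fin n) ℂ) := by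
      ext i j
      by_cases hij : i = j
      · subst hij; simp
      · simp [hij]
    rw [h3, mul_sub, sub_mul]
    have h4 : (U : Matrix (Fin n) (Fin n) ℂ) * (U : Matrix (Fin n) (Fin n) ℂ)ᴴ = 1 := Unitary.coe_mul_star_self U
    rw [mul_smul_comm, smul_mul_assoc, mul_one, h4]
    rw [← Matrix.star_eq_conjTranspose, ← hs]
  rw [h2]
  apply Matrix.PosSemidef.mul_mul_conjTranspose_same
  rw [Matrix.posSemidef_diagonal_iff]
  intro i
  exact_mod_cast sub_nonneg.2 (h i)

lemma Rm_bound_t (hd : ∀ i, 0 < d i) (hK : K.PosDef) {κ : ℝ} (hκ : 0 < κ)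
   (hKκ : (K - κ • (1 : Matrix (Fin n) (Fin n) ℂ)).PosSemidef) {s t : ℝ} (ht : 0 < t) (i : Fin n) :
    t * κ * (Rm d K s t i i).re ≤ 1 := by
  have hH := (Rm_posDef (s := s) hd hK ht).isHermitian
  have h1 := Rm_self (s := s) hd hK ht i
  have h2 := RKR_nonneg (s := s) hd hK hKκ ht i
  have h3 := Rm_diag_pos (s := s) hd hK ht i
  have h4 : 0 ≤ ∑ j, d j ^ s * Complex.normSq (Rm d K s t i j) :=
    Finset.sum_nonneg 
      (fun j _ => mul_nonneg (Real.rpow_pos_of_pos (hd j) s).le (Complex.normSq_nonneg _))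
  have h8 : ((Rm d K s t * Rm d K s t) i i).re = ∑ j, Complex.normSq (Rm d K s t i j) := by
    rw [Matrix.mul_apply, Complex.re_sum]
    refine Finset.sum_congr rfl fun j _ => ?_
    rw [← hH.apply j i, Complex.star_def, Complex.mul_conj, Complex.ofReal_re]
  have h9 : Complex.normSq (Rm d K s t i i) ≤ ∑ j, Complex.normSq (Rm d K s t i j) :=
    Finset.single_le_sum (f := fun j => Complex.normSq (Rm d K s t i j))
      (fun j _ => (Complex.normSq_nonneg _)) (Finset.mem_univ i)
  have h10 : ((Rm d K s t * (K - κ • (1 : Matrix (Fin n) (Fin n) ℂ)) * Rm d K s t) i i).re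
    = ((Rm d K s t * K * Rm d K s t) i i).re - κ * ((Rm d K s t * Rm d K s t) i i).re := by
    simp [mul_sub, sub_mul]
  have h5 := (Rm_le_normSq (d := d) (K := K) i s t).trans h9
  rw [h10, h8] at h2
  have h6 : t * (κ * (Rm d K s t i i).re ^ 2) ≤ t * ((Rm d K s t * K * Rm d K s t) i i).re := by
    apply mul_le_mul_of_nonneg_left _ ht.le
    nlinarith
  have h7 : (t * κ * (Rm d K s t i i).re) * (Rm d K s t i i).re ≤ 1 * (Rm d K s t i i).re := by nlinarith
  exact le_of_mul_le_mul_right h7 h3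


lemma rpow_le_add {x a b c : ℝ} (hx : 0 < x) (h1 : a ≤ c) (h2 : c ≤ b) : x ^ c ≤ x ^ a + x ^ b := by
  have ha := Real.rpow_pos_of_pos hx a
  have hb := Real.rpow_pos_of_pos hx b
  rcases le_total 1 x with h | h
  · have := Real.rpow_le_rpow_of_exponent_le h h2; linarith
  · have := Real.rpow_le_rpow_of_exponent_ge hx h h1; linarith

lemma sym_term {x y m s : ℝ} (hx : 0 < x) (hy : 0 < y) (hms : s ≤ m) :
    0 ≤ (Real.log x - Real.log y) * (x ^ m * y ^ s - y ^ m * x ^ s) := by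
  wlog h : y ≤ x generalizing x y
  · have := this hy hx (le_of_not_ge h); linarith
  have h1 : Real.log y ≤ Real.log x := Real.log_le_log hy h
  have h2 : y ^ (m - s) ≤ x ^ (m - s) := Real.rpow_le_rpow hy.le h (by linarith)
  have e1 : x ^ m = x ^ (m - s) * x ^ s := by rw [← Real.rpow_add hx]; congr 1; ring
  have e2 : y ^ m = y ^ (m - s) * y ^ s := by rw [← Real.rpow_add hy]; congr 1; ring
  rw [e1, e2]
  have h3 : 0 < x ^ s * y ^ s := mul_pos (Real.rpow_pos_of_pos hx s) (Real.rpow_pos_of_pos hy s)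
  have : (x ^ (m - s) * x ^ s * y ^ s - y ^ (m - s) * y ^ s * x ^ s) = (x ^ (m - s) - y ^ (m-s)) * (x ^ s * y ^ s) := by ring
  rw [this]
  exact mul_nonneg (by linarith) (mul_nonneg (by linarith) h3.le)

lemma sym_sum (hd : ∀ i, 0 < d i) (c : Fin n → Fin n → ℝ) (hc : ∀ i j, 0 ≤ c i j)
    (hs : ∀ i j, c i j = c j i) {m s : ℝ} (hms : s ≤ m) :
    0 ≤ ∑ i, ∑ j, d i ^ m * d j ^ s * c i j * (Real.log (d i) - Real.log (d j)) := by
  have h1 : ∑ i, ∑ j, d i ^ m * d j ^ s * c i j * (Real.log (d i) - Real.log (d j)) =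
    ∑ i, ∑ j, d j ^ m * d i ^ s * c j i * (Real.log (d j) - Real.log (d i)) := Finset.sum_comm
  have h2 : 0 ≤ ∑ i, ∑ j, d i ^ m * d j ^ s * c i j * (Real.log (d i) - Real.log (d j)) +
    ∑ i, ∑ j, d j ^ m * d i ^ s * c j i * (Real.log (d j) - Real.log (d i)) := by
    rw [← Finset.sum_add_distrib]
    refine Finset.sum_nonneg fun i _ => ?_
    rw [← Finset.sum_add_distrib]
    refine Finset.sum_nonneg fun j _ => ?_
    rw [hs j i]
    have := mul_nonneg (hc i j) (sym_term (hd i) (hd j) hms)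
    linarith
  linarith

noncomputable def Tf (d : Fin n → ℝ) (K : Matrix (Fin n) (Fin n) ℂ) (ρ θ s t : ℝ) : ℝ :=
  t ^ (θ - 1) * ∑ i, d i ^ (ρ + θ + (1 - θ) * s) * (Rm d K s t i i).re

noncomputable def Ts (d : Fin n → ℝ) (K : Matrix (Fin n) (Fin n) ℂ) (ρ θ s t : ℝ) : ℝ :=
  t ^ (θ - 1) * ∑ i, ((d i ^ (ρ + θ + (1 - θ) * s) * Real.log (d i) * (1 - θ)) * (Rm d K s t i i).re +
    d i ^ (ρ + θ + (1 - θ) * s) * (-∑ j, d j ^ s * Real.log (d j) * Complex.normSq (Rm d K s t i j)))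

noncomputable def Qf (d : Fin n → ℝ) (K : Matrix (Fin n) (Fin n) ℂ) (ρ θ s t : ℝ) : ℝ :=
  t ^ θ * ∑ i, Real.log (d i) * d i ^ (ρ + θ + (1 - θ) * s) * (Rm d K s t i i).re

noncomputable def Qt (d : Fin n → ℝ) (K : Matrix (Fin n) (Fin n) ℂ) (ρ θ s t : ℝ) : ℝ :=
  t ^ (θ - 1) * ∑ i, Real.log (d i) * d i ^ (ρ + θ + (1 - θ) * s) * ((θ - 1) * (Rm d K s t i i).re
    + ∑ j, d j ^ s * Complex.normSq (Rm d K s t i j))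

lemma Tf_deriv (hd : ∀ i, 0 < d i) (hK : K.PosDef) (ρ θ : ℝ) {s t : ℝ} (ht : 0 < t) :
    HasDerivAt (fun s => Tf d K ρ θ s t) (Ts d K ρ θ s t) s := by
  unfold Tf Ts
  apply HasDerivAt.const_mul
  apply HasDerivAt.fun_sum
  intro i _
  refine HasDerivAt.mul ?_ (Rm_deriv_s hd hK ht i)
  have h : HasDerivAt (fun s : ℝ => ρ + θ + (1 - θ) * s) (1 - θ) s := by
    simpa using ((hasDerivAt_id s).const_mul (1 - θ)).const_add (ρ + θ)
  have := h.const_rpow (hd i)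
  exact this.congr_deriv (by ring)

lemma Qf_deriv (hd : ∀ i, 0 < d i) (hK : K.PosDef) (ρ θ : ℝ) {s t : ℝ} (ht : 0 < t) :
    HasDerivAt (fun t => Qf d K ρ θ s t) (Qt d K ρ θ s t) t := by
  unfold Qf Qt
  have h1 : HasDerivAt (fun t : ℝ => ∑ i, Real.log (d i) * d i ^ (ρ + θ + (1 - θ) * s) * (Rm d K s t i i).re)
    (∑ i, Real.log (d i) * d i ^ (ρ + θ + (1 - θ) * s) * (-(Rm d K s t * K * Rm d K s t) i i).re) t := by
    apply HasDerivAt.fun_sum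
    intro i _
    exact (Rm_deriv_t hd hK ht i).const_mul _
  have h2 : HasDerivAt (fun t : ℝ => t ^ θ) (θ * t ^ (θ - 1)) t :=
    Real.hasDerivAt_rpow_const (Or.inl ht.ne')
  refine (h2.mul h1).congr_deriv ?_
  symm
  have h3 : t ^ θ = t ^ (θ - 1) * t := by
    rw [Real.rpow_sub_one ht.ne']; field_simp
  rw [h3, mul_comm θ, mul_assoc, mul_assoc, ← mul_add]
  congr 1
  rw [Finset.mul_sum, Finset.mul_sum, ← Finset.sum_add_distrib]
  refine Finset.sum_congr rfl fun i _ => ?_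
  have h4 := Rm_self (s := s) hd hK ht i
  have h5 : ∑ j, d j ^ s * Complex.normSq (Rm d K s t i j) = (Rm d K s t i i).re
      - t * ((Rm d K s t * K * Rm d K s t) i i).re := by linarith
  rw [h5, Complex.neg_re]
  ring

lemma Ts_add_Qt (hd : ∀ i, 0 < d i) (hK : K.PosDef) {ρ θ : ℝ} (hρ : 0 ≤ ρ) (hθ : 0 < θ)
    {s t : ℝ} (hs : s ≤ 1) (ht : 0 < t) :
    0 ≤ Ts d K ρ θ s t + Qt d K ρ θ s t := by
  have hH := (Rm_posDef (s := s) hd hK ht).isHermitian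
  have h := sym_sum hd (fun i j => Complex.normSq (Rm d K s t i j)) (fun i j => Complex.normSq_nonneg _)
    (fun i j => by rw [← hH.apply i j, Complex.star_def, Complex.normSq_conj])
    (m := ρ + θ + (1 - θ) * s) (s := s) (by nlinarith)
  have h2 := mul_nonneg (Real.rpow_pos_of_pos ht (θ - 1)).le h
  refine h2.trans_eq ?_
  symm
  unfold Ts Qt
  rw [← mul_add, ← Finset.sum_add_distrib]
  congr 1
  refine Finset.sum_congr rfl fun i _ => ?_
  have e : ∑ j, d i ^ (ρ + θ + (1 - θ) * s) * d j ^ s * Complex.normSq (Rm d K s t i j) * (Real.log (d i) - Real.log (d j))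
    = d i ^ (ρ + θ + (1 - θ) * s) * Real.log (d i) * ∑ j, d j ^ s * Complex.normSq (Rm d K s t i j)
     - d i ^ (ρ + θ + (1 - θ) * s) * ∑ j, d j ^ s * Real.log (d j) * Complex.normSq (Rm d K s t i j) := by
    rw [Finset.mul_sum, Finset.mul_sum, ← Finset.sum_sub_distrib]
    refine Finset.sum_congr rfl fun j _ => ?_
    ring
  rw [e]
  ring

lemma entry_continuousOn (hd : ∀ i, 0 < d i) (hK : K.PosDef) (i j : Fin n) :
    ContinuousOn (fun z : ℝ × ℝ => Rm d K z.1 z.2 i j) {z | 0 < z.2} := 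
  ((continuous_id.matrix_elem i j).comp_continuousOn (Rm_continuousOn hd hK))

lemma re_continuousOn (hd : ∀ i, 0 < d i) (hK : K.PosDef) (i j : Fin n) :
    ContinuousOn (fun z : ℝ × ℝ => (Rm d K z.1 z.2 i j).re) {z | 0 < z.2} := 
  Complex.continuous_re.comp_continuousOn (entry_continuousOn hd hK i j)

lemma nsq_continuousOn (hd : ∀ i, 0 < d i) (hK : K.PosDef) (i j : Fin n) :
    ContinuousOn (fun z : ℝ × ℝ => Complex.normSq (Rm d K z.1 z.2 i j)) {z | 0 < z.2} := 
  Complex.continuous_normSq.comp_continuousOn (entry_continuousOn hd hK i j)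

lemma dpow_continuous (hd : ∀ i, 0 < d i) (i : Fin n) (a b : ℝ) :
    Continuous (fun z : ℝ × ℝ => d i ^ (a + b * z.1)) :=
  Continuous.rpow continuous_const (by fun_prop) (fun z => Or.inl (hd i).ne')

lemma dpow_continuous' (hd : ∀ i, 0 < d i) (i : Fin n) :
    Continuous (fun z : ℝ × ℝ => d i ^ (z.1)) :=
  Continuous.rpow continuous_const (by fun_prop) (fun z => Or.inl (hd i).ne')

lemma tpow_continuousOn (a : ℝ) : ContinuousOn (fun z : ℝ × ℝ => z.2 ^ a) {z | 0 < z.2} := 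
  ContinuousOn.rpow_const continuousOn_snd (fun _ hz => Or.inl (ne_of_gt hz))

lemma Ts_continuousOn (hd : ∀ i, 0 < d i) (hK : K.PosDef) (ρ θ : ℝ) :
    ContinuousOn (fun z : ℝ × ℝ => Ts d K ρ θ z.1 z.2) {z | 0 < z.2} := by
  unfold Ts
  refine (tpow_continuousOn _).mul (continuousOn_finsetSum _ fun i _ => ?_)
  have h1 := (dpow_continuous hd i (ρ + θ) (1 - θ)).continuousOn (s := {z : ℝ × ℝ | 0 < z.2})
  refine ContinuousOn.add (((h1.mul continuousOn_const).mul continuousOn_const).mul (re_continuousOn hd hK i i)) ?_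
  refine h1.mul (ContinuousOn.neg (continuousOn_finsetSum _ fun j _ => ?_))
  exact ((dpow_continuous' hd j).continuousOn.mul continuousOn_const).mul (nsq_continuousOn hd hK i j)

lemma Qt_continuousOn (hd : ∀ i, 0 < d i) (hK : K.PosDef) (ρ θ : ℝ) :
    ContinuousOn (fun z : ℝ × ℝ => Qt d K ρ θ z.1 z.2) {z | 0 < z.2} := by
  unfold Qt
  refine (tpow_continuousOn _).mul (continuousOn_finsetSum _ fun i _ => ?_)
  have h1 := (dpow_continuous hd i (ρ + θ) (1 - θ)).continuousOn (s := {z : ℝ × ℝ | 0 < z.2})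
  refine (continuousOn_const.mul h1).mul (ContinuousOn.add (continuousOn_const.mul (re_continuousOn hd hK i i)) ?_)
  refine (continuousOn_finsetSum _ fun j _ => ?_)
  exact ((dpow_continuous' hd j).continuousOn).mul (nsq_continuousOn hd hK i j)

lemma Qf_continuousOn (hd : ∀ i, 0 < d i) (hK : K.PosDef) (ρ θ : ℝ) :
    ContinuousOn (fun z : ℝ × ℝ => Qf d K ρ θ z.1 z.2) {z | 0 < z.2} := by
  unfold Qf
  refine (tpow_continuousOn _).mul (continuousOn_finsetSum _ fun i _ => ?_)
  have h1 := (dpow_continuous hd i (ρ + θ) (1 - θ)).continuousOn (s := {z : ℝ × ℝ | 0 < z.2})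
  exact (continuousOn_const.mul h1).mul (re_continuousOn hd hK i i)

lemma Tf_continuousOn (hd : ∀ i, 0 < d i) (hK : K.PosDef) (ρ θ : ℝ) :
    ContinuousOn (fun z : ℝ × ℝ => Tf d K ρ θ z.1 z.2) {z | 0 < z.2} := by
  unfold Tf
  refine (tpow_continuousOn _).mul (continuousOn_finsetSum _ fun i _ => ?_)
  have h1 := (dpow_continuous hd i (ρ + θ) (1 - θ)).continuousOn (s := {z : ℝ × ℝ | 0 < z.2})
  exact h1.mul (re_continuousOn hd hK i i)

lemma sec_s {F : ℝ × ℝ → ℝ} (hF : ContinuousOn F {z | 0 < z.2}) {t : ℝ} (ht : 0 < t) (a b : ℝ) :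
    IntervalIntegrable (fun s => F (s, t)) MeasureTheory.volume a b :=
  ContinuousOn.intervalIntegrable (hF.comp (by fun_prop) (fun s _ => ht))

lemma sec_t {F : ℝ × ℝ → ℝ} (hF : ContinuousOn F {z | 0 < z.2}) {a b : ℝ} (ha : 0 < a) (hab : a ≤ b) (s : ℝ) :
    IntervalIntegrable (fun t => F (s, t)) MeasureTheory.volume a b :=
  ContinuousOn.intervalIntegrable (hF.comp (by fun_prop) (fun t ht => by
    rw [Set.uIcc_of_le hab] at ht; exact lt_of_lt_of_le ha ht.1))

lemma Qf_bound (hd : ∀ i, 0 < d i) (hK : K.PosDef) {ρ θ : ℝ} (hθ : 0 < θ) (hθ1 : θ < 1) :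
    ∃ C : ℝ, ∀ s t, 0 ≤ s → s ≤ 1 → 0 < t → |Qf d K ρ θ s t| ≤ C * t ^ θ ∧ 
      |Qf d K ρ θ s t| ≤ C * t ^ (θ - 1) := by
  obtain ⟨κ, hκ, hKκ⟩ := exists_kappa hK
  let C1 := ∑ i, |Real.log (d i)| * (d i ^ ρ + d i ^ (ρ + θ))
  let C2 := ∑ i, |Real.log (d i)| * (d i ^ (ρ + θ) + d i ^ (ρ + 1)) * κ⁻¹
  have hC1 : 0 ≤ C1 := Finset.sum_nonneg fun i _ => by
    have := Real.rpow_pos_of_pos (hd i) ρ; have := Real.rpow_pos_of_pos (hd i) (ρ + θ); positivity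
  have hC2 : 0 ≤ C2 := Finset.sum_nonneg fun i _ => by
    have := Real.rpow_pos_of_pos (hd i) (ρ+1); have := Real.rpow_pos_of_pos (hd i) (ρ + θ); positivity
  refine ⟨C1 + C2, fun s t hs hs1 ht => ?_⟩
  have hA : |Qf d K ρ θ s t| ≤ t ^ θ * ∑ i, |Real.log (d i)| * d i ^ (ρ + θ + (1 - θ) * s) * (Rm d K s t i i).re := by
    unfold Qf
    rw [abs_mul, abs_of_pos (Real.rpow_pos_of_pos ht θ)]
    refine mul_le_mul_of_nonneg_left ((Finset.abs_sum_le_sum_abs _ _).trans_eq ?_) (Real.rpow_pos_of_pos ht θ).le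
    refine Finset.sum_congr rfl fun i _ => ?_
    rw [abs_mul, abs_mul, abs_of_pos (Real.rpow_pos_of_pos (hd i) _), abs_of_pos (Rm_diag_pos hd hK ht i)]
  have hB1 : ∑ i, |Real.log (d i)| * d i ^ (ρ + θ + (1 - θ) * s) * (Rm d K s t i i).re ≤ C1 := by
    refine Finset.sum_le_sum fun i _ => ?_
    have e : d i ^ (ρ + θ + (1 - θ) * s) = d i ^ (ρ + θ * (1 - s)) * d i ^ s := by
      rw [← Real.rpow_add (hd i)]; congr 1; ring
    have h1 := Rm_bound_d (s := s) hd hK ht i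
    have h2 : d i ^ (ρ + θ * (1 - s)) ≤ d i ^ ρ + d i ^ (ρ + θ) := 
      rpow_le_add (hd i) (by nlinarith) (by nlinarith)
    have h3 := Real.rpow_pos_of_pos (hd i) (ρ + θ * (1 - s))
    rw [e, mul_assoc]
    refine mul_le_mul_of_nonneg_left ?_ (abs_nonneg _)
    nlinarith
  have hB2 : ∑ i, |Real.log (d i)| * d i ^ (ρ + θ + (1 - θ) * s) * (Rm d K s t i i).re ≤ C2 * t⁻¹ := by
    rw [Finset.sum_mul]
    refine Finset.sum_le_sum fun i _ => ?_
    have h1 := Rm_bound_t (s := s) hd hK hκ hKκ ht i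
    have h2 : d i ^ (ρ + θ + (1 - θ) * s) ≤ d i ^ (ρ + θ) + d i ^ (ρ + 1) := 
      rpow_le_add (hd i) (by nlinarith) (by nlinarith)
    have h3 := Real.rpow_pos_of_pos (hd i) (ρ + θ + (1 - θ) * s)
    have h4 : (Rm d K s t i i).re ≤ κ⁻¹ * t⁻¹ := by
      rw [← mul_inv, ← one_div, le_div_iff₀ (by positivity)]; linarith
    have h5 := Rm_diag_pos (s := s) hd hK ht i
    rw [mul_assoc, mul_assoc, mul_assoc]
    refine mul_le_mul_of_nonneg_left ?_ (abs_nonneg _)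
    exact mul_le_mul h2 h4 h5.le (by linarith)
  have hp := Real.rpow_pos_of_pos ht θ
  constructor
  · calc _ ≤ _ := hA
      _ ≤ t ^ θ * C1 := mul_le_mul_of_nonneg_left hB1 hp.le
      _ ≤ _ := by nlinarith
  · calc _ ≤ _ := hA
      _ ≤ t ^ θ * (C2 * t⁻¹) := mul_le_mul_of_nonneg_left hB2 hp.le
      _ = C2 * t ^ (θ - 1) := by rw [Real.rpow_sub_one ht.ne']; field_simp
      _ ≤ _ := by nlinarith [Real.rpow_pos_of_pos ht (θ - 1)]

open MeasureTheory in
lemma rect_ineq (hd : ∀ i, 0 < d i) (hK : K.PosDef) {ρ θ : ℝ} (hρ : 0 ≤ ρ) (hθ : 0 < θ) (hθ1 : θ < 1) :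
    ∃ C : ℝ, ∀ ε N, 0 < ε → ε ≤ N → 
      (∫ t in ε..N, Tf d K ρ θ 0 t) ≤ (∫ t in ε..N, Tf d K ρ θ 1 t) + C * (ε ^ θ + N ^ (θ - 1)) := by
  obtain ⟨C, hC⟩ := Qf_bound (ρ := ρ) hd hK hθ hθ1
  refine ⟨C, fun ε N hε hεN => ?_⟩
  have hN : 0 < N := hε.trans_le hεN
  have hTs := Ts_continuousOn hd hK ρ θ
  have hQt := Qt_continuousOn hd hK ρ θ
  have hQf := Qf_continuousOn hd hK ρ θ
  have hTf := Tf_continuousOn hd hK ρ θ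
  have e1 : (∫ t in ε..N, Tf d K ρ θ 1 t) - (∫ t in ε..N, Tf d K ρ θ 0 t) =
      ∫ t in ε..N, ∫ s in (0:ℝ)..1, Ts d K ρ θ s t := by
    rw [← intervalIntegral.integral_sub (sec_t hTf hε hεN 1) (sec_t hTf hε hεN 0)]
    apply intervalIntegral.integral_congr
    intro t ht
    rw [Set.uIcc_of_le hεN] at ht
    have ht0 : 0 < t := lt_of_lt_of_le hε ht.1
    exact (intervalIntegral.integral_eq_sub_of_hasDerivAt (fun s _ => Tf_deriv hd hK ρ θ ht0)
      (sec_s hTs ht0 0 1)).symm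
  have hI : IntegrableOn (Function.uncurry fun s t => Ts d K ρ θ s t) (Set.Ioc 0 1 ×ˢ Set.Ioc ε N) := by
    have : IntegrableOn (Function.uncurry fun s t => Ts d K ρ θ s t) (Set.Icc 0 1 ×ˢ Set.Icc ε N) := by
      apply ContinuousOn.integrableOn_compact (isCompact_Icc.prod isCompact_Icc)
      exact hTs.mono (fun z hz => lt_of_lt_of_le hε hz.2.1)
    exact this.mono_set (Set.prod_mono Set.Ioc_subset_Icc_self Set.Ioc_subset_Icc_self)
  have e2 : ∫ t in ε..N, ∫ s in (0:ℝ)..1, Ts d K ρ θ s t = ∫ s in (0:ℝ)..1, ∫ t in ε..N, Ts d K ρ θ s t := by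
    symm
    apply intervalIntegral_intervalIntegral_swap
    rw [Set.uIoc_of_le zero_le_one, Set.uIoc_of_le hεN]
    exact hI
  have key : ∀ s ∈ Set.Icc (0:ℝ) 1, -(C * (ε ^ θ + N ^ (θ - 1))) ≤ ∫ t in ε..N, Ts d K ρ θ s t := by
    intro s hs
    have h1 : ∫ t in ε..N, Qt d K ρ θ s t = Qf d K ρ θ s N - Qf d K ρ θ s ε := by
      apply intervalIntegral.integral_eq_sub_of_hasDerivAt _ (sec_t hQt hε hεN s)
      intro t ht
      rw [Set.uIcc_of_le hεN] at ht
      exact Qf_deriv hd hK ρ θ (lt_of_lt_of_le hε ht.1)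
    have h2 : ∫ t in ε..N, - Qt d K ρ θ s t ≤ ∫ t in ε..N, Ts d K ρ θ s t := by
      apply intervalIntegral.integral_mono_on hεN (sec_t hQt hε hεN s).neg (sec_t hTs hε hεN s)
      intro t ht
      have := Ts_add_Qt hd hK hρ hθ hs.2 (lt_of_lt_of_le hε ht.1)
      change - Qt d K ρ θ s t ≤ Ts d K ρ θ s t
      linarith
    rw [intervalIntegral.integral_neg, h1] at h2
    have h3 := (abs_le.1 (hC s ε hs.1 hs.2 hε).1)
    have h4 := (abs_le.1 (hC s N hs.1 hs.2 hN).2)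
    linarith
  have hint : IntervalIntegrable (fun s => ∫ t in ε..N, Ts d K ρ θ s t) volume 0 1 := by
    rw [intervalIntegrable_iff_integrableOn_Ioc_of_le zero_le_one]
    simp_rw [intervalIntegral.integral_of_le hεN]
    rw [IntegrableOn, Measure.volume_eq_prod, ← Measure.prod_restrict] at hI
    exact hI.integral_prod_left
  have fin := intervalIntegral.integral_mono_on zero_le_one (intervalIntegrable_const) hint key
  rw [intervalIntegral.integral_const] at fin
  rw [← e2, ← e1] at fin
  simp at fin
  linarith

open MeasureTheory Filter Topology in
lemma full_ineq (hd : ∀ i, 0 < d i) (hK : K.PosDef) {ρ θ : ℝ} (hρ : 0 ≤ ρ) (hθ : 0 < θ) (hθ1 : θ < 1)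
    (h0 : IntegrableOn (fun t => Tf d K ρ θ 0 t) (Set.Ioi 0))
    (h1 : IntegrableOn (fun t => Tf d K ρ θ 1 t) (Set.Ioi 0)) :
    ∫ t in Set.Ioi (0:ℝ), Tf d K ρ θ 0 t ≤ ∫ t in Set.Ioi (0:ℝ), Tf d K ρ θ 1 t := by
  obtain ⟨C, hC⟩ := rect_ineq hd hK hρ hθ hθ1
  let e : ℕ → ℝ := fun k => 1 / ((k : ℝ) + 1)
  let N : ℕ → ℝ := fun k => (k : ℝ) + 1
  have he : Tendsto e atTop (𝓝 0) := tendsto_one_div_add_atTop_nhds_zero_nat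
  have hN : Tendsto N atTop atTop := tendsto_atTop_add_const_right _ _ tendsto_natCast_atTop_atTop
  have hcov : AECover (volume.restrict (Set.Ioi (0:ℝ))) atTop (fun k => Set.Ioi (e k) ∩ Set.Iic (N k)) :=
    (aecover_Ioi_of_Ioi he).inter (aecover_Iic hN)
  have hpos : ∀ k, 0 < e k := fun k => by positivity
  have hle : ∀ k, e k ≤ N k := fun k => by
    have : (0:ℝ) ≤ k := Nat.cast_nonneg k
    change 1 / ((k : ℝ) + 1) ≤ (k : ℝ) + 1
    rw [div_le_iff₀ (by positivity)]; nlinarith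
  have hconv : ∀ f : ℝ → ℝ, ∀ k, (∫ t in Set.Ioi (e k) ∩ Set.Iic (N k), f t ∂(volume.restrict (Set.Ioi (0:ℝ))))
      = ∫ t in (e k)..(N k), f t := by
    intro f k
    rw [intervalIntegral.integral_of_le (hle k), Measure.restrict_restrict (measurableSet_Ioi.inter measurableSet_Iic)]
    congr 2
    ext x
    simp only [Set.mem_inter_iff, Set.mem_Ioi, Set.mem_Iic, Set.mem_Ioc]
    exact ⟨fun h => h.1, fun h => ⟨h, (hpos k).trans h.1⟩⟩
  have t0 := hcov.integral_tendsto_of_countably_generated h0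
  have t1 := hcov.integral_tendsto_of_countably_generated h1
  simp_rw [hconv] at t0 t1
  have t2 : Tendsto (fun k => C * ((e k) ^ θ + (N k) ^ (θ - 1))) atTop (𝓝 0) := by
    have a1 : Tendsto (fun k => (e k) ^ θ) atTop (𝓝 0) := by
      have := he.rpow_const (p := θ) (Or.inr hθ.le)
      rwa [Real.zero_rpow hθ.ne'] at this
    have a2 : Tendsto (fun k => (N k) ^ (θ - 1)) atTop (𝓝 0) := by
      have := (tendsto_rpow_neg_atTop (y := 1 - θ) (by linarith)).comp hN
      simpa [Function.comp_def] using this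
    simpa using (a1.add a2).const_mul C
  have t3 := t1.add t2
  rw [add_zero] at t3
  exact le_of_tendsto_of_tendsto' t0 t3 (fun k => hC _ _ (hpos k) (hle k))

noncomputable def Ud (U : Matrix (Fin n) (Fin n) ℂ) (f : Fin n → ℝ) : Matrix (Fin n) (Fin n) ℂ :=
  U * diagonal (fun i => (f i : ℂ)) * Uᴴ

lemma Ud_mul {U : Matrix (Fin n) (Fin n) ℂ} (hU : Uᴴ * U = 1) (f g : Fin n → ℝ) :
    Ud U f * Ud U g = Ud U (fun i => f i * g i) := by
  unfold Ud
  calc _ = U * diagonal (fun i => (f i : ℂ)) * (Uᴴ * U) * diagonal (fun i => (g i : ℂ)) * Uᴴ := by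
        simp only [mul_assoc]
    _ = _ := by
        rw [hU, mul_one, mul_assoc U, Matrix.diagonal_mul_diagonal]
        simp

lemma Ud_one {U : Matrix (Fin n) (Fin n) ℂ} (hU : U * Uᴴ = 1) : Ud U (fun _ => 1) = 1 := by
  unfold Ud; simp [hU]

lemma Ud_add (U : Matrix (Fin n) (Fin n) ℂ) (f g : Fin n → ℝ) :
    Ud U f + Ud U g = Ud U (fun i => f i + g i) := by
  unfold Ud
  rw [← add_mul, ← mul_add, Matrix.diagonal_add]; simp

lemma Ud_smul (U : Matrix (Fin n) (Fin n) ℂ) (f : Fin n → ℝ) (t : ℝ) :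
    t • Ud U f = Ud U (fun i => t * f i) := by
  unfold Ud
  rw [← smul_mul_assoc, ← mul_smul_comm, ← Matrix.diagonal_smul]
  congr; ext i; simp

lemma Ud_inv {U : Matrix (Fin n) (Fin n) ℂ} (hU : Uᴴ * U = 1) {f : Fin n → ℝ} (hf : ∀ i, f i ≠ 0) :
    (Ud U f)⁻¹ = Ud U (fun i => (f i)⁻¹) := by
  apply Matrix.inv_eq_right_inv
  rw [Ud_mul hU]
  simp [hf]
  exact Ud_one (mul_eq_one_comm.1 hU)

lemma Ud_trace (U M : Matrix (Fin n) (Fin n) ℂ) (f : Fin n → ℝ) :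
    (trace (M * Ud U f)).re = ∑ i, f i * ((Uᴴ * M * U) i i).re := by
  unfold Ud
  rw [← mul_assoc, ← mul_assoc, Matrix.trace_mul_comm, ← mul_assoc, ← mul_assoc, trace, Complex.re_sum]
  refine Finset.sum_congr rfl fun i _ => ?_
  rw [diag_apply, Matrix.mul_diagonal]
  simp [mul_comm]

lemma Ud_posDef {U : Matrix (Fin n) (Fin n) ℂ} (hU : Uᴴ * U = 1) {f : Fin n → ℝ} (hf : ∀ i, 0 < f i) :
    (Ud U f).PosDef := by
  unfold Ud
  have h1 : (diagonal (fun i => (f i : ℂ))).PosDef := by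
    rw [Matrix.posDef_diagonal_iff]; intro i; exact_mod_cast hf i
  have hu : IsUnit U := IsUnit.of_mul_eq_one _ (mul_eq_one_comm.1 hU)
  exact (Matrix.IsUnit.posDef_star_right_conjugate_iff hu).2 h1

lemma exists_Ud {A : Matrix (Fin n) (Fin n) ℂ} (hA : A.PosDef) :
    ∃ (U : Matrix (Fin n) (Fin n) ℂ) (a : Fin n → ℝ), Uᴴ * U = 1 ∧ (∀ i, 0 < a i) ∧ A = Ud U a ∧
      ∀ f : ℝ → ℝ, cfc f A = Ud U (fun i => f (a i)) := by
  refine ⟨hA.isHermitian.eigenvectorUnitary, hA.isHermitian.eigenvalues, 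
    Unitary.coe_star_mul_self _, hA.eigenvalues_pos, ?_, ?_⟩
  · have := hA.isHermitian.spectral_theorem
    rw [Unitary.conjStarAlgAut_apply] at this
    exact this
  · intro f
    rw [hA.isHermitian.cfc_eq, Matrix.IsHermitian.cfc, Unitary.conjStarAlgAut_apply]
    rfl

open MeasureTheory in
lemma integral_rep {Z : Matrix (Fin n) (Fin n) ℂ} (hZ : Z.PosDef) (M : Matrix (Fin n) (Fin n) ℂ)
    {θ : ℝ} (hθ : 0 < θ) (hθ1 : θ < 1) :
    IntegrableOn (fun t => t ^ (θ - 1) * (trace (M * (1 + t • Z⁻¹)⁻¹)).re) (Set.Ioi 0) ∧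
    ∫ t in Set.Ioi (0:ℝ), t ^ (θ - 1) * (trace (M * (1 + t • Z⁻¹)⁻¹)).re =
      (trace (M * mpow Z θ)).re * ∫ t in Set.Ioi (0:ℝ), Real.rpowIntegrand₀₁ θ t 1 := by
  obtain ⟨U, a, hU, ha, hZU, hf⟩ := exists_Ud hZ
  have hm : θ ∈ Set.Ioo (0:ℝ) 1 := ⟨hθ, hθ1⟩
  have heq : Set.EqOn (fun t => t ^ (θ - 1) * (trace (M * (1 + t • Z⁻¹)⁻¹)).re)
     (fun t => ∑ i, Real.rpowIntegrand₀₁ θ t (a i) * ((Uᴴ * M * U) i i).re) (Set.Ioi 0) := by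
    intro t ht
    have ht : 0 < t := ht
    have e : (1 + t • Z⁻¹)⁻¹ = Ud U (fun i => a i / (t + a i)) := by
      rw [hZU, Ud_inv hU (fun i => (ha i).ne'), ← Ud_one (mul_eq_one_comm.1 hU), Ud_smul, Ud_add, Ud_inv hU]
      · congr 1; funext i
        have := ha i
        field_simp
        ring
      · intro i; have := ha i; positivity
    simp only
    rw [e, Ud_trace, Finset.mul_sum]
    refine Finset.sum_congr rfl fun i _ => ?_
    rw [Real.rpowIntegrand₀₁_eq_pow_div hm ht.le (ha i).le]
    ring
  have hint : ∀ i ∈ Finset.univ, IntegrableOn (fun t => Real.rpowIntegrand₀₁ θ t (a i) * ((Uᴴ * M * U) i i).re) (Set.Ioi 0) :=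
    fun i _ => (Real.integrableOn_rpowIntegrand₀₁_Ioi hm (ha i).le).mul_const _
  constructor
  · rw [integrableOn_congr_fun heq measurableSet_Ioi]
    exact integrable_finsetSum _ hint
  · rw [setIntegral_congr_fun measurableSet_Ioi heq, integral_finsetSum _ hint]
    unfold mpow
    rw [hf, Ud_trace, Finset.sum_mul]
    refine Finset.sum_congr rfl fun i _ => ?_
    rw [integral_mul_const, Real.integral_rpowIntegrand₀₁_eq_rpow_mul_const hm (ha i).le]
    ring

lemma mpow_posDef {A : Matrix (Fin n) (Fin n) ℂ} (hA : A.PosDef) (s : ℝ) : (mpow A s).PosDef := by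
  obtain ⟨U, a, hU, ha, hZU, hf⟩ := exists_Ud hA
  unfold mpow
  rw [hf]
  exact Ud_posDef hU (fun i => Real.rpow_pos_of_pos (ha i) s)

lemma mpow_mul {A : Matrix (Fin n) (Fin n) ℂ} (hA : A.PosDef) (s t : ℝ) :
    mpow A s * mpow A t = mpow A (s + t) := by
  obtain ⟨U, a, hU, ha, hZU, hf⟩ := exists_Ud hA
  unfold mpow
  rw [hf, hf, hf, Ud_mul hU]
  congr 1; funext i; rw [Real.rpow_add (ha i)]

lemma mpow_mpow {A : Matrix (Fin n) (Fin n) ℂ} (hA : A.PosDef) (s t : ℝ) :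
    mpow (mpow A s) t = mpow A (s * t) := by
  have hc : ∀ (B : Matrix (Fin n) (Fin n) ℂ), ∀ f : ℝ → ℝ, B.PosDef → ContinuousOn f (spectrum ℝ B) := by
    intro B f hB
    exact (Matrix.finite_real_spectrum (A := B)).continuousOn f
  have hsp : ∀ x ∈ spectrum ℝ A, 0 < x := by
    intro x hx
    rw [hA.isHermitian.spectrum_real_eq_range_eigenvalues] at hx
    obtain ⟨i, rfl⟩ := hx
    exact hA.eigenvalues_pos i
  unfold mpow
  rw [← cfc_comp' (fun x : ℝ => x ^ t) (fun x : ℝ => x ^ s) A ?_ (hc _ _ hA) hA.isHermitian.isSelfAdjoint]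
  · apply cfc_congr
    intro x hx
    exact (Real.rpow_mul (hsp x hx).le s t).symm
  · exact ((Matrix.finite_real_spectrum (A := A)).image _).continuousOn _

lemma mpow_one {A : Matrix (Fin n) (Fin n) ℂ} (hA : A.PosDef) : mpow A 1 = A := by
  obtain ⟨U, a, hU, ha, hZU, hf⟩ := exists_Ud hA
  unfold mpow
  rw [hf]
  simp only [Real.rpow_one]
  exact hZU.symm

lemma posDef_case (A B : Matrix (Fin n) (Fin n) ℂ) (hA : A.PosDef) (hB : B.PosDef)
    (p q r : ℝ) (hq : 0 < q) (hqp : q ≤ p) (hr : 0 ≤ r) :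
    (Matrix.trace (mpow A (r + q) * mpow B q)).re ≤
      (Matrix.trace (mpow A r * mpow (mpow A (p/2) * mpow B p * mpow A (p/2)) (q/p))).re := by
  have hp : 0 < p := hq.trans_le hqp
  have hb := mpow_posDef hB p
  set b := mpow B p with hbdef
  have hPd := mpow_posDef hA (p / 2)
  have hPP : mpow A (p / 2) * mpow A (p / 2) = mpow A p := by rw [mpow_mul hA]; ring_nf
  have hPu : IsUnit (mpow A (p/2)) := hPd.isUnit
  have hZ : (mpow A (p/2) * b * mpow A (p/2)).PosDef := by
    have := (Matrix.IsUnit.posDef_star_right_conjugate_iff hPu).2 hb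
    rwa [Matrix.star_eq_conjTranspose, hPd.isHermitian.eq] at this
  have htr : ∀ X, trace (mpow A r * (mpow A (p/2) * X * mpow A (p/2))) = trace (mpow A (r + p) * X) := by
    intro X
    rw [← mul_assoc, Matrix.trace_mul_comm, ← mul_assoc, ← mul_assoc, mpow_mul hA, mpow_mul hA]
    ring_nf
  rcases hqp.eq_or_lt with h | h
  · subst h
    rw [div_self hq.ne', mpow_one hZ, htr]
  have hθ : 0 < q / p := by positivity
  have hθ1 : q / p < 1 := by rw [div_lt_one hp]; exact h
  have hBq : mpow B q = mpow b (q / p) := by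
    rw [hbdef, mpow_mpow hB]; congr 1; field_simp
  rw [hBq]
  set θ := q / p with hθdef
  obtain ⟨U, a, hU, ha, hAU, hf⟩ := exists_Ud hA
  have hU' := mul_eq_one_comm.1 hU
  have hUu : IsUnit Uᴴ := IsUnit.of_mul_eq_one _ hU
  let d : Fin n → ℝ := fun i => a i ^ p
  have hd : ∀ i, 0 < d i := fun i => Real.rpow_pos_of_pos (ha i) p
  let K : Matrix (Fin n) (Fin n) ℂ := Uᴴ * b⁻¹ * U
  have hK : K.PosDef := by
    have := (Matrix.IsUnit.posDef_star_right_conjugate_iff hUu).2 hb.inv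
    rwa [Matrix.star_eq_conjTranspose, Matrix.conjTranspose_conjTranspose] at this
  have hUinv : U⁻¹ = Uᴴ := Matrix.inv_eq_left_inv hU
  have hUHinv : Uᴴ⁻¹ = U := Matrix.inv_eq_left_inv hU'
  have hpw : ∀ s, mpow A s = Ud U (fun i => a i ^ s) := fun s => hf _
  have conj : ∀ s t, Rm d K s t = Uᴴ * (mpow A (p * s) + t • b⁻¹)⁻¹ * U := by
    intro s t
    have : Sm d K s t = Uᴴ * (mpow A (p * s) + t • b⁻¹) * U := by
      rw [hpw, mul_add, add_mul, Sm]
      congr 1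
      · unfold Ud
        have : Uᴴ * (U * diagonal (fun i => ((a i ^ (p * s) : ℝ) : ℂ)) * Uᴴ) * U =
           (Uᴴ * U) * diagonal (fun i => ((a i ^ (p * s) : ℝ) : ℂ)) * (Uᴴ * U) := by simp only [mul_assoc]
        rw [this, hU, one_mul, mul_one]
        congr 1; funext i
        rw [Real.rpow_mul (ha i).le]
      · simp [K]
    rw [Rm, this, Matrix.mul_inv_rev, Matrix.mul_inv_rev, hUinv, hUHinv, mul_assoc]
  have T0 : ∀ t, Tf d K (r / p) θ 0 t = t ^ (θ - 1) * (trace (mpow A (r + q) * (1 + t • b⁻¹)⁻¹)).re := by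
    intro t
    have h1 : mpow A (p * 0) = 1 := by rw [hpw]; simpa using Ud_one hU'
    rw [Tf, conj, h1, Matrix.trace_mul_comm, hpw, Ud_trace]
    congr 1
    refine Finset.sum_congr rfl fun i _ => ?_
    congr 1
    rw [← Real.rpow_mul (ha i).le]
    congr 1
    rw [hθdef]; field_simp; ring
  have T1 : ∀ t, 0 < t → Tf d K (r / p) θ 1 t = t ^ (θ - 1) * (trace (mpow A r * (1 + t • (mpow A (p/2) * b * mpow A (p/2))⁻¹)⁻¹)).re := by
    intro t ht
    have hdet := (Matrix.isUnit_iff_isUnit_det _).1 hPu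
    have e : (1 + t • (mpow A (p/2) * b * mpow A (p/2))⁻¹)⁻¹ = 
        mpow A (p/2) * (mpow A p + t • b⁻¹)⁻¹ * mpow A (p/2) := by
      have : 1 + t • (mpow A (p/2) * b * mpow A (p/2))⁻¹ = 
          (mpow A (p/2))⁻¹ * (mpow A p + t • b⁻¹) * (mpow A (p/2))⁻¹ := by
        rw [Matrix.mul_inv_rev, Matrix.mul_inv_rev, ← hPP, mul_add, add_mul,
          ← mul_assoc (mpow A (p/2))⁻¹ (mpow A (p/2)) (mpow A (p/2)),
          Matrix.nonsing_inv_mul _ hdet, one_mul, Matrix.mul_nonsing_inv _ hdet]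
        simp [mul_assoc]
      rw [this, Matrix.mul_inv_rev, Matrix.mul_inv_rev, Matrix.nonsing_inv_nonsing_inv _ hdet, mul_assoc]
    rw [e, htr, Tf, conj, mul_one p, Matrix.trace_mul_comm, hpw (r + p), Ud_trace]
    congr 1
    refine Finset.sum_congr rfl fun i _ => ?_
    congr 1
    rw [← Real.rpow_mul (ha i).le]
    congr 1
    field_simp; ring
  obtain ⟨i0, v0⟩ := integral_rep hb (mpow A (r + q)) hθ hθ1
  obtain ⟨i1, v1⟩ := integral_rep hZ (mpow A r) hθ hθ1
  have e0 : Set.EqOn (fun t => Tf d K (r / p) θ 0 t) _ (Set.Ioi 0) := fun t _ => T0 t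
  have e1 : Set.EqOn (fun t => Tf d K (r / p) θ 1 t) _ (Set.Ioi 0) := fun t ht => T1 t ht
  have key := full_ineq hd hK (ρ := r / p) (by positivity) hθ hθ1
    ((MeasureTheory.integrableOn_congr_fun e0 measurableSet_Ioi).2 i0)
    ((MeasureTheory.integrableOn_congr_fun e1 measurableSet_Ioi).2 i1)
  rw [MeasureTheory.setIntegral_congr_fun measurableSet_Ioi e0, v0,
    MeasureTheory.setIntegral_congr_fun measurableSet_Ioi e1, v1] at key
  exact le_of_mul_le_mul_right key (Real.integral_rpowIntegrand₀₁_one_pos ⟨hθ, hθ1⟩)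

lemma mpow_continuous {F : ℝ → Matrix (Fin n) (Fin n) ℂ} (hF : Continuous F) (hH : ∀ x, (F x).IsHermitian)
    {s : ℝ} (hs : 0 ≤ s) : Continuous (fun x => mpow (F x) s) := by
  unfold mpow
  exact Continuous.cfc_of_mem_nhdsSet (s := Set.univ) _ Filter.univ_mem hF (fun x => (hH x).isSelfAdjoint)
    (Real.continuous_rpow_const hs).continuousOn

lemma mpow_herm (A : Matrix (Fin n) (Fin n) ℂ) (s : ℝ) : (mpow A s).IsHermitian := by
  unfold mpow
  exact (cfc_predicate (p := IsSelfAdjoint) _ A).isHermitian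

end core

/-- GBLP trace inequality (direct direction): for `A, B` positive semidefinite, `0 < q ≤ p`
and `r ≥ 0`: `Tr[A^{r+q} B^q] ≤ Tr[A^r (A^{p/2} B^p A^{p/2})^{q/p}]` (as real parts). -/
theorem stmt_12 {n : ℕ} (A B : Matrix (Fin n) (Fin n) ℂ)
    (hA : A.PosSemidef) (hB : B.PosSemidef)
    (p q r : ℝ) (hq : 0 < q) (hqp : q ≤ p) (hr : 0 ≤ r) :
    (Matrix.trace (mpow A (r + q) * mpow B q)).re ≤
      (Matrix.trace (mpow A r * mpow (mpow A (p/2) * mpow B p * mpow A (p/2)) (q/p))).re := by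
  have hp : 0 < p := hq.trans_le hqp
  let E : Matrix (Fin n) (Fin n) ℂ → ℝ → Matrix (Fin n) (Fin n) ℂ := fun X ε => X + ε • 1
  have hE0 : ∀ X, E X 0 = X := fun X => by simp [E]
  have hEc : ∀ X, Continuous (E X) := fun X => by
    simp only [E]
    fun_prop
  have h1H : (1 : Matrix (Fin n) (Fin n) ℂ).PosDef := Matrix.PosDef.one
  have hEp : ∀ X : Matrix (Fin n) (Fin n) ℂ, X.PosSemidef → ∀ ε, 0 < ε → (E X ε).PosDef := fun X hX ε hε =>
    Matrix.PosDef.posSemidef_add hX (h1H.smul hε)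
  have hEh : ∀ X : Matrix (Fin n) (Fin n) ℂ, X.PosSemidef → ∀ ε, (E X ε).IsHermitian := fun X hX ε => by
    refine hX.isHermitian.add ?_
    rw [Matrix.IsHermitian, Matrix.conjTranspose_smul, Matrix.conjTranspose_one]
    simp
  have cA : ∀ s : ℝ, 0 ≤ s → Continuous (fun ε => mpow (E A ε) s) := fun s hs =>
    mpow_continuous (hEc A) (hEh A hA) hs
  have cB : ∀ s : ℝ, 0 ≤ s → Continuous (fun ε => mpow (E B ε) s) := fun s hs =>
    mpow_continuous (hEc B) (hEh B hB) hs
  have cL : Continuous (fun ε => (Matrix.trace (mpow (E A ε) (r + q) * mpow (E B ε) q)).re) :=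
    Complex.continuous_re.comp (((cA _ (by positivity)).mul (cB _ hq.le)).matrix_trace)
  have cR : Continuous (fun ε => (Matrix.trace (mpow (E A ε) r * mpow (mpow (E A ε) (p/2) * mpow (E B ε) p * mpow (E A ε) (p/2)) (q/p))).re) := by
    refine Complex.continuous_re.comp (((cA _ hr).mul (mpow_continuous ?_ ?_ (by positivity))).matrix_trace)
    · exact ((cA _ (by positivity)).mul (cB _ hp.le)).mul (cA _ (by positivity))
    · intro ε
      have := Matrix.isHermitian_mul_mul_conjTranspose (mpow (E A ε) (p/2)) (mpow_herm (E B ε) p)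
      rwa [(mpow_herm (E A ε) (p/2)).eq] at this
  have tL := (cL.tendsto 0).mono_left (nhdsWithin_le_nhds (s := Set.Ioi 0))
  have tR := (cR.tendsto 0).mono_left (nhdsWithin_le_nhds (s := Set.Ioi 0))
  simp only [hE0] at tL tR
  refine le_of_tendsto_of_tendsto tL tR ?_
  filter_upwards [self_mem_nhdsWithin] with ε hε
  exact posDef_case _ _ (hEp A hA ε hε) (hEp B hB ε hε) p q r hq hqp hr
end

section
/- (GBLP trace inequality, reversed direction.) Let A and B be n×n complex positive semidefinite matrices. Then for all real numbers p, q, r with 0 ≤ r ≤ p ≤ q and p > 0: Tr[A^r · (A^{p/2} B^p A^{p/2})^{q/p}] ≤ Tr[A^{r+q} · B^q]. (Both traces are real; equivalently the inequality holds between their real parts.) -/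
open scoped ComplexOrder

section op
variable {𝒜 : Type*} [CStarAlgebra 𝒜] [PartialOrder 𝒜] [StarOrderedRing 𝒜]

lemma aux_conj {C X Y : 𝒜} (_hC : IsStrictlyPositive C) (z : ℝ) (h : X ≤ Y) :
    C ^ z * X * C ^ z ≤ C ^ z * Y * C ^ z :=
  conjugate_le_conjugate_of_nonneg h CFC.rpow_nonneg

lemma aux_sp {C B : 𝒜} (hC : IsStrictlyPositive C) (hB : IsStrictlyPositive B) (z : ℝ) :
    IsStrictlyPositive (C ^ z * B * C ^ z) := by
  have hz := (IsStrictlyPositive.rpow C z hC)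
  refine (IsStrictlyPositive.iff_of_unital).2 ⟨conjugate_nonneg_of_nonneg hB.nonneg hz.nonneg, ?_⟩
  exact (hz.isUnit.mul hB.isUnit).mul hz.isUnit

lemma aux_pow {B C : 𝒜} (hC : IsStrictlyPositive C) (hB : IsStrictlyPositive B) {a b t : ℝ}
    (ha : 0 ≤ a) (hb : 0 ≤ b) (ht : 0 ≤ t) (ht1 : t ≤ 1) (h : B ^ a ≤ C ^ b) :
    B ^ (a * t) ≤ C ^ (b * t) := by
  have := CFC.rpow_le_rpow (p := t) ⟨ht, ht1⟩ h
  rwa [CFC.rpow_rpow_of_exponent_nonneg _ _ _ ha ht hB.nonneg,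
    CFC.rpow_rpow_of_exponent_nonneg _ _ _ hb ht hC.nonneg] at this

lemma aux_neg {B C : 𝒜} (hC : IsStrictlyPositive C) (hB : IsStrictlyPositive B) {a b : ℝ}
    (h : B ^ a ≤ C ^ b) :
    C ^ (-b) ≤ B ^ (-a) := by
  have h1 := aux_conj hB (-a) (aux_conj hC (-b) h)
  have hB' := IsStrictlyPositive.rpow B a hB
  have := CStarAlgebra.ringInverse_le_ringInverse h hB'
  have e : ∀ (X : 𝒜) (_ : IsStrictlyPositive X) (x : ℝ), Ring.inverse (X ^ x) = X ^ (-x) := by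
    intro X hX x
    have hx := (IsStrictlyPositive.rpow X x hX).isUnit
    have := Ring.mul_inverse_cancel _ hx
    calc Ring.inverse (X ^ x) = X ^ (-x) * X ^ x * Ring.inverse (X ^ x) := by
          rw [CFC.rpow_neg_mul_rpow x hX, one_mul]
      _ = _ := by rw [mul_assoc, this, mul_one]
  rwa [e _ hC, e _ hB] at this

/-- ladder step -/
lemma aux_step {B C : 𝒜} (hC : IsStrictlyPositive C) (hB : IsStrictlyPositive B) {r s a : ℝ}
    (hr : 0 ≤ r) (hs : 2 ≤ s) (h : B ^ s ≤ C ^ (r + s)) (ha : 0 ≤ a) (hx1 : a * r / s ≤ 1)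
    (hT : (C ^ (-(1/2) : ℝ) * B * C ^ (-(1/2) : ℝ)) ^ a ≤ C ^ (a * r / s)) :
    (C ^ (-(1/2) : ℝ) * B * C ^ (-(1/2) : ℝ)) ^ (a + 2) ≤ C ^ ((a + 2) * r / s) := by
  have hTs := aux_sp hC hB (-(1/2))
  set T := C ^ (-(1/2) : ℝ) * B * C ^ (-(1/2) : ℝ) with hTdef
  have hs0 : 0 < s := by linarith
  have hrs : 0 < r + s := by linarith
  set x := a * r / s with hx
  have hx0 : 0 ≤ x := by positivity
  have e1 : T ^ (a + 2) = T * T ^ a * T := by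
    rw [show a + 2 = 1 + a + 1 by ring, CFC.rpow_add hTs.isUnit, CFC.rpow_add hTs.isUnit,
      CFC.rpow_one T hTs.nonneg]
  have e2 : T * T ^ a * T ≤ T * C ^ x * T := conjugate_le_conjugate_of_nonneg hT hTs.nonneg
  have e3 : T * C ^ x * T = C ^ (-(1/2) : ℝ) * (B * C ^ (-(1 - x)) * B) * C ^ (-(1/2) : ℝ) := by
    rw [show -(1 - x) = -(1/2) + x + -(1/2) by ring, CFC.rpow_add hC.isUnit, CFC.rpow_add hC.isUnit]
    simp only [hTdef, mul_assoc]
  have e4 : C ^ (-(1 - x)) ≤ B ^ (-((1 - x) * s / (r + s))) := by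
    apply aux_neg hC hB
    have := aux_pow hC hB hs0.le hrs.le (t := (1 - x) / (r + s)) (by apply div_nonneg <;> linarith)
      (by rw [div_le_one hrs]; linarith) h
    convert this using 2 <;> field_simp
  have e5 : B * C ^ (-(1 - x)) * B ≤ B ^ (2 - (1 - x) * s / (r + s)) := by
    refine (conjugate_le_conjugate_of_nonneg e4 hB.nonneg).trans (le_of_eq ?_)
    rw [show 2 - (1 - x) * s / (r + s) = 1 + -((1 - x) * s / (r + s)) + 1 by ring,
      CFC.rpow_add hB.isUnit, CFC.rpow_add hB.isUnit, CFC.rpow_one B hB.nonneg]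
  have e6 : B ^ (2 - (1 - x) * s / (r + s)) ≤ C ^ (2 * (r + s) / s - 1 + x) := by
    have hle : (1 - x) * s / (r + s) ≤ 1 := by
      rw [div_le_one hrs]; nlinarith
    have hge : 0 ≤ (1 - x) * s / (r + s) := by
      apply div_nonneg _ hrs.le; apply mul_nonneg <;> linarith
    have := aux_pow hC hB hs0.le hrs.le (t := (2 - (1 - x) * s / (r + s)) / s)
      (by apply div_nonneg <;> linarith) (by rw [div_le_one hs0]; linarith) h
    convert this using 2 <;> field_simp
    ring
  rw [e1]
  refine e2.trans ?_
  rw [e3]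
  refine (aux_conj hC _ (e5.trans e6)).trans (le_of_eq ?_)
  rw [← CFC.rpow_add hC.isUnit, ← CFC.rpow_add hC.isUnit]
  congr 1
  rw [hx]; field_simp; ring

lemma aux_polar {Z T : 𝒜} (hZ : IsUnit Z) (hTZ : star Z * Z = T) (hT : IsStrictlyPositive T) (b : ℝ) :
    T ^ (1 + b) = star Z * (Z * star Z) ^ b * Z := by
  have hR := CFC.rpow_nonneg (a := T) (y := -(1/2))
  have hRs : star (T ^ (-(1/2) : ℝ)) = T ^ (-(1/2) : ℝ) := IsSelfAdjoint.of_nonneg hR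
  set U := Z * T ^ (-(1/2) : ℝ) with hU
  have hUu : IsUnit U := hZ.mul (IsStrictlyPositive.rpow T _ hT).isUnit
  have h1 : star U * U = 1 := by
    rw [hU, star_mul, hRs, mul_assoc, ← mul_assoc (star Z), hTZ]
    conv_lhs => enter [2, 1]; rw [← CFC.rpow_one T hT.nonneg]
    rw [← CFC.rpow_add hT.isUnit, ← CFC.rpow_add hT.isUnit]
    norm_num
    exact CFC.rpow_zero T hT.nonneg
  have h2 : U * star U = 1 := by
    obtain ⟨u, hu⟩ := hUu
    have : star U = ↑u⁻¹ := by
      rw [← hu] at h1 ⊢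
      exact (Units.inv_eq_of_mul_eq_one_left h1).symm
    rw [this, ← hu, Units.mul_inv]
  have hZU : Z = U * T ^ (1/2 : ℝ) := by
    rw [hU, mul_assoc, ← CFC.rpow_add hT.isUnit]
    norm_num
    rw [CFC.rpow_zero T hT.nonneg, mul_one]
  clear_value U
  have hR' : star (T ^ (1/2 : ℝ)) = T ^ (1/2 : ℝ) := IsSelfAdjoint.of_nonneg CFC.rpow_nonneg
  have hzz : Z * star Z = U * T * star U := by
    rw [hZU, star_mul, hR', mul_assoc, ← mul_assoc (T ^ (1/2 : ℝ)), ← CFC.rpow_add hT.isUnit]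
    norm_num
    rw [CFC.rpow_one T hT.nonneg, mul_assoc]
  have hpow : (U * T * star U) ^ b = U * T ^ b * star U := by
    let φ := Unitary.conjStarAlgAut ℝ 𝒜 ⟨U, h1, h2⟩
    have hφ : ∀ X, φ X = U * X * star U := fun X => rfl
    have hn : 0 ≤ U * T * star U := star_right_conjugate_nonneg hT.nonneg U
    rw [CFC.rpow_eq_cfc_real hn, CFC.rpow_eq_cfc_real hT.nonneg, ← hφ, ← hφ]
    refine (StarAlgHomClass.map_cfc φ _ T ?_ ?_ ?_ ?_).symm
    · intro x hx
      apply ContinuousAt.continuousWithinAt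
      apply Real.continuousAt_rpow_const
      left
      rintro rfl
      exact spectrum.zero_notMem ℝ hT.isUnit hx
    · show Continuous fun X => U * X * star U
      fun_prop
    · exact IsSelfAdjoint.of_nonneg hT.nonneg
    · exact IsSelfAdjoint.of_nonneg hn
  rw [hzz, hpow, hZU, star_mul, hR']
  calc T ^ (1 + b) = T ^ (1/2 : ℝ) * T ^ b * T ^ (1/2 : ℝ) := by
        rw [← CFC.rpow_add hT.isUnit, ← CFC.rpow_add hT.isUnit]; congr 1; ring
    _ = T ^ (1/2 : ℝ) * (star U * U) * T ^ b * ((star U * U) * T ^ (1/2 : ℝ)) := by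
        rw [h1]; simp
    _ = _ := by simp only [mul_assoc]

lemma aux_small {B C : 𝒜} (hC : IsStrictlyPositive C) (hB : IsStrictlyPositive B) {r s : ℝ}
    (hr : 0 ≤ r) (hs : 1 ≤ s) (hs2 : s ≤ 2) (h : B ^ s ≤ C ^ (r + s)) :
    (C ^ (-(1/2) : ℝ) * B * C ^ (-(1/2) : ℝ)) ^ s ≤ C ^ r := by
  have hTs := aux_sp hC hB (-(1/2))
  have hs0 : 0 < s := by linarith
  have hrs : 0 < r + s := by linarith
  have hRC : star (C ^ (-(1/2) : ℝ)) = C ^ (-(1/2) : ℝ) := IsSelfAdjoint.of_nonneg CFC.rpow_nonneg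
  have hRB : star (B ^ (1/2 : ℝ)) = B ^ (1/2 : ℝ) := IsSelfAdjoint.of_nonneg CFC.rpow_nonneg
  have hBB : B ^ (1/2 : ℝ) * B ^ (1/2 : ℝ) = B := by
    rw [← CFC.rpow_add hB.isUnit]; norm_num; exact CFC.rpow_one B hB.nonneg
  have hCC : C ^ (-(1/2) : ℝ) * C ^ (-(1/2) : ℝ) = C ^ (-1 : ℝ) := by
    rw [← CFC.rpow_add hC.isUnit]; norm_num
  have key := aux_polar (Z := B ^ (1/2 : ℝ) * C ^ (-(1/2) : ℝ)) (T := C ^ (-(1/2) : ℝ) * B * C ^ (-(1/2) : ℝ))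
    ((IsStrictlyPositive.rpow B _ hB).isUnit.mul (IsStrictlyPositive.rpow C _ hC).isUnit)
    (by rw [star_mul, hRC, hRB, mul_assoc, ← mul_assoc (B ^ (1/2 : ℝ)), hBB, mul_assoc]) hTs (s - 1)
  rw [show 1 + (s - 1) = s by ring] at key
  rw [key, star_mul, hRC, hRB]
  have e0 : B ^ (1/2 : ℝ) * C ^ (-(1/2) : ℝ) * (C ^ (-(1/2) : ℝ) * B ^ (1/2 : ℝ))
      = B ^ (1/2 : ℝ) * C ^ (-1 : ℝ) * B ^ (1/2 : ℝ) := by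
    rw [← hCC]; simp only [mul_assoc]
  rw [e0]
  have e4 : C ^ (-1 : ℝ) ≤ B ^ (-(s / (r + s))) := by
    apply aux_neg hC hB
    have := aux_pow hC hB hs0.le hrs.le (t := 1 / (r + s)) (by positivity)
      (by rw [div_le_one hrs]; linarith) h
    convert this using 2 <;> field_simp
  have e5 : B ^ (1/2 : ℝ) * C ^ (-1 : ℝ) * B ^ (1/2 : ℝ) ≤ B ^ (r / (r + s)) := by
    refine (aux_conj hB _ e4).trans (le_of_eq ?_)
    rw [← CFC.rpow_add hB.isUnit, ← CFC.rpow_add hB.isUnit]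
    congr 1; field_simp; ring
  have e6 : (B ^ (1/2 : ℝ) * C ^ (-1 : ℝ) * B ^ (1/2 : ℝ)) ^ (s - 1) ≤ B ^ (r / (r + s) * (s - 1)) := by
    refine (CFC.rpow_le_rpow (p := s - 1) ⟨by linarith, by linarith⟩ e5).trans (le_of_eq ?_)
    exact CFC.rpow_rpow_of_exponent_nonneg _ _ _ (by positivity) (by linarith) hB.nonneg
  have e7 : B ^ (1/2 + r / (r + s) * (s - 1) + 1/2) ≤ C ^ (1 + r) := by
    have := aux_pow hC hB hs0.le hrs.le (t := (1 + r) / (r + s)) (by positivity)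
      (by rw [div_le_one hrs]; linarith) h
    convert this using 2 <;> field_simp
    ring
  rw [CFC.rpow_add hB.isUnit, CFC.rpow_add hB.isUnit] at e7
  have e8 := aux_conj hC (-(1/2)) ((aux_conj hB (1/2) e6).trans e7)
  rw [← CFC.rpow_add hC.isUnit, ← CFC.rpow_add hC.isUnit,
    show -(1/2) + (1 + r) + -(1/2) = r by ring] at e8
  simpa only [mul_assoc] using e8

lemma aux_big {B C : 𝒜} (hC : IsStrictlyPositive C) (hB : IsStrictlyPositive B) {r s : ℝ}
    (hr : 0 ≤ r) (hr1 : r ≤ 1) (hs : 2 ≤ s) (h : B ^ s ≤ C ^ (r + s)) (k : ℕ) :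
    ∀ a : ℝ, 0 ≤ a → a ≤ 2 → a + 2 * k ≤ s →
    (C ^ (-(1/2) : ℝ) * B * C ^ (-(1/2) : ℝ)) ^ (a + 2 * k) ≤ C ^ ((a + 2 * k) * r / s) := by
  have hTs := aux_sp hC hB (-(1/2))
  have hs0 : 0 < s := by linarith
  induction k with
  | zero =>
    intro a ha ha2 _
    have h2 := aux_step hC hB hr hs h (a := 0) le_rfl (by simp) (by
      rw [CFC.rpow_zero _ hTs.nonneg]; simp [CFC.rpow_zero _ hC.nonneg])
    have := aux_pow hC hTs (by norm_num) (by positivity) (t := a / 2) (by positivity) (by linarith) h2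
    convert this using 2 <;> push_cast <;> field_simp <;> ring
  | succ k ih =>
    intro a ha ha2 hle
    push_cast at hle
    have := aux_step hC hB hr hs h (a := a + 2 * k) (by positivity)
      (by rw [div_le_one hs0]; nlinarith) (ih a ha ha2 (by linarith))
    convert this using 2 <;> push_cast <;> ring

lemma op_main {B C : 𝒜} (hC : IsStrictlyPositive C) (hB : IsStrictlyPositive B) {r s : ℝ}
    (hr : 0 ≤ r) (hr1 : r ≤ 1) (hs : 1 ≤ s) (h : B ^ s ≤ C ^ (r + s)) :
    (C ^ (-(1/2) : ℝ) * B * C ^ (-(1/2) : ℝ)) ^ s ≤ C ^ r := by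
  rcases le_total s 2 with h2 | h2
  · exact aux_small hC hB hr hs h2 h
  · have hk := Nat.floor_le (a := s / 2) (by positivity)
    have hk' := Nat.lt_floor_add_one (s / 2)
    have := aux_big hC hB hr hr1 h2 h ⌊s / 2⌋₊ (s - 2 * ⌊s / 2⌋₊) (by linarith) (by linarith) (by linarith)
    rw [sub_add_cancel, mul_div_cancel_left₀ _ (by positivity)] at this
    exact this
end op

section num
lemma num1 (n : ℕ) (x y : ℕ → ℝ) (hx : ∀ i < n, 0 < x i) (hy : ∀ i < n, 0 < y i)
    (hanti : ∀ i, i + 1 < n → x (i + 1) ≤ x i)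
    (h : ∀ k ≤ n, ∏ i ∈ Finset.range k, x i ≤ ∏ i ∈ Finset.range k, y i) :
    ∑ i ∈ Finset.range n, x i ≤ ∑ i ∈ Finset.range n, y i := by
  set L : ℕ → ℝ := fun i => Real.log (y i) - Real.log (x i) with hL
  have hP : ∀ k ≤ n, 0 ≤ ∑ i ∈ Finset.range k, L i := by
    intro k hk
    have hxk : ∀ i ∈ Finset.range k, x i ≠ 0 := fun i hi => (hx i (by simp at hi; omega)).ne'
    have hyk : ∀ i ∈ Finset.range k, y i ≠ 0 := fun i hi => (hy i (by simp at hi; omega)).ne'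
    rw [Finset.sum_sub_distrib, ← Real.log_prod hxk, ← Real.log_prod hyk, sub_nonneg]
    exact Real.log_le_log (Finset.prod_pos fun i hi => hx i (by simp at hi; omega)) (h k hk)
  have key : ∀ m, m < n → x m * ∑ i ∈ Finset.range (m+1), L i ≤ ∑ i ∈ Finset.range (m+1), x i * L i := by
    intro m
    induction m with
    | zero => intro _; simp
    | succ m ih =>
      intro hm
      rw [Finset.sum_range_succ, Finset.sum_range_succ _ (m+1), mul_add]
      have h1 := ih (by omega)
      have h2 := mul_le_mul_of_nonneg_right (hanti m hm) (hP (m+1) (by omega))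
      linarith
  have h0 : 0 ≤ ∑ i ∈ Finset.range n, x i * L i := by
    rcases n with _ | m
    · simp
    · exact (mul_nonneg (hx m (by omega)).le (hP _ le_rfl)).trans (key m (by omega))
  have h1 : ∑ i ∈ Finset.range n, x i * L i ≤ ∑ i ∈ Finset.range n, (y i - x i) := by
    apply Finset.sum_le_sum
    intro i hi
    have hxi := hx i (by simpa using hi)
    have hyi := hy i (by simpa using hi)
    have := Real.log_le_sub_one_of_pos (div_pos hyi hxi)
    rw [Real.log_div hyi.ne' hxi.ne'] at this
    calc x i * L i ≤ x i * (y i / x i - 1) := by gcongr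
      _ = _ := by field_simp
  rw [Finset.sum_sub_distrib] at h1
  linarith

lemma num_le {n : ℕ} (y : Fin n → ℝ) (hy : ∀ i, 0 < y i) (hanti : Antitone y) (S : Finset (Fin n)) :
    ∏ i ∈ S, y i ≤ ∏ i ∈ Finset.univ.filter (fun i : Fin n => (i : ℕ) < S.card), y i := by
  have hS : S.card ≤ n := by simpa using S.card_le_univ
  have e1 : ∏ i ∈ S, y i = ∏ j : Fin S.card, y (S.orderEmbOfFin rfl j) := by
    conv_lhs => rw [← Finset.image_orderEmbOfFin_univ S rfl]
    rw [Finset.prod_image fun _ _ _ _ h => (Finset.orderEmbOfFin S rfl).injective h]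
  have e2 : Finset.univ.filter (fun i : Fin n => (i : ℕ) < S.card)
      = Finset.univ.map (Fin.castLEEmb hS) := by
    ext i
    simp only [Finset.mem_filter, Finset.mem_univ, true_and, Finset.mem_map]
    constructor
    · intro h; exact ⟨⟨i, h⟩, rfl⟩
    · rintro ⟨j, rfl⟩; exact j.2
  rw [e1, e2, Finset.prod_map]
  apply Finset.prod_le_prod (fun _ _ => (hy _).le)
  intro j _
  apply hanti
  have : ∀ (m : ℕ) (hm : m < S.card), m ≤ (S.orderEmbOfFin rfl ⟨m, hm⟩ : ℕ) := by
    intro m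
    induction m with
    | zero => intro _; omega
    | succ m ih =>
      intro hm
      have h1 := ih (by omega)
      have h2 : S.orderEmbOfFin rfl ⟨m, by omega⟩ < S.orderEmbOfFin rfl ⟨m+1, hm⟩ :=
        (S.orderEmbOfFin rfl).strictMono (by simp [Fin.lt_def])
      rw [Fin.lt_def] at h2
      omega
  exact this j j.2

lemma num3 {n : ℕ} (x y : Fin n → ℝ) (hx : ∀ i, 0 < x i) (hy : ∀ i, 0 < y i)
    (hxa : Antitone x) (hya : Antitone y)
    (H : ∀ k M, (∀ S : Finset (Fin n), S.card = k → ∏ i ∈ S, y i ≤ M) →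
      ∀ S : Finset (Fin n), S.card = k → ∏ i ∈ S, x i ≤ M) : ∑ i, x i ≤ ∑ i, y i := by
  have conv : ∀ (z : Fin n → ℝ), ∀ k ≤ n, ∏ i ∈ Finset.univ.filter (fun i : Fin n => (i : ℕ) < k), z i
      = ∏ i ∈ Finset.range k, (if h : i < n then z ⟨i, h⟩ else 1) := by
    intro z k hk
    symm
    refine Finset.prod_bij' (fun i hi => (⟨i, by simp at hi; omega⟩ : Fin n)) (fun j _ => (j : ℕ)) ?_ ?_ ?_ ?_ ?_
    · intro i hi; simpa using hi
    · intro i hi; simpa using hi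
    · intro i hi; rfl
    · intro i hi; rfl
    · intro i hi
      rw [dif_pos]
  have := num1 n (fun i => if h : i < n then x ⟨i, h⟩ else 1) (fun i => if h : i < n then y ⟨i, h⟩ else 1)
    (by intro i hi; simp [hi, hx]) (by intro i hi; simp [hi, hy])
    (by
      intro i hi
      simp only [hi, show i < n by omega, dite_true]
      exact hxa (by simp [Fin.le_def]))
    (by
      intro k hk
      rw [← conv x k hk, ← conv y k hk]
      have hc : (Finset.univ.filter (fun i : Fin n => (i : ℕ) < k)).card = k := by
        rw [Fin.card_filter_val_lt]; omega
      refine H k _ ?_ _ hc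
      intro S hS
      have := num_le y hy hya S
      rwa [hS] at this)
  rw [← Fin.sum_univ_eq_sum_range, ← Fin.sum_univ_eq_sum_range] at this
  simpa using this

lemma num4 {n : ℕ} (x y : Fin n → ℝ) (hx : ∀ i, 0 < x i) (hy : ∀ i, 0 < y i)
    (H : ∀ k M, (∀ S : Finset (Fin n), S.card = k → ∏ i ∈ S, y i ≤ M) →
      ∀ S : Finset (Fin n), S.card = k → ∏ i ∈ S, x i ≤ M) : ∑ i, x i ≤ ∑ i, y i := by
  set σ := Tuple.sort (fun i => - x i)
  set τ := Tuple.sort (fun i => - y i)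
  have hσ : Antitone (x ∘ σ) := fun i j h => by
    have := Tuple.monotone_sort (fun i => - x i) h
    simpa using this
  have hτ : Antitone (y ∘ τ) := fun i j h => by
    have := Tuple.monotone_sort (fun i => - y i) h
    simpa using this
  have := num3 (x ∘ σ) (y ∘ τ) (fun _ => hx _) (fun _ => hy _) hσ hτ (by
    intro k M h S hS
    have := H k M (by
      intro S hS
      have := h (S.map τ.symm.toEmbedding) (by simpa using hS)
      simpa [Finset.prod_map] using this) (S.map σ.toEmbedding) (by simpa using hS)
    simpa [Finset.prod_map] using this)
  simpa [Equiv.sum_comp σ x, Equiv.sum_comp τ y] using this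
end num

section mat
open scoped ComplexOrder MatrixOrder Matrix.Norms.L2Operator
open Matrix

noncomputable def compd {n : ℕ} (k : ℕ) (X : Matrix (Fin n) (Fin n) ℂ) :
    Matrix (Set.powersetCard (Fin n) k) (Set.powersetCard (Fin n) k) ℂ :=
  LinearMap.toMatrix ((Pi.basisFun ℂ (Fin n)).exteriorPower k) ((Pi.basisFun ℂ (Fin n)).exteriorPower k)
    (exteriorPower.map k (Matrix.toLin' X))

lemma compd_mul {n k : ℕ} (X Y : Matrix (Fin n) (Fin n) ℂ) : compd k (X * Y) = compd k X * compd k Y := by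
  have h := exteriorPower.map_comp (n := k) (toLin' Y) (toLin' X)
  rw [compd, Matrix.toLin'_mul, h, LinearMap.toMatrix_comp _ ((Pi.basisFun ℂ (Fin n)).exteriorPower k)]
  rfl

lemma compd_one {n k : ℕ} : compd k (1 : Matrix (Fin n) (Fin n) ℂ) = 1 := by
  rw [compd, Matrix.toLin'_one, exteriorPower.map_id, LinearMap.toMatrix_id]

lemma compd_apply {n k : ℕ} (X : Matrix (Fin n) (Fin n) ℂ) (s t) :
    compd k X s t = (X.submatrix (Set.powersetCard.ofFinEmbEquiv.symm s) (Set.powersetCard.ofFinEmbEquiv.symm t)).det := by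
  rw [compd, LinearMap.toMatrix_apply, exteriorPower.basis_apply, exteriorPower.map_apply_ιMulti_family,
    ← Module.Basis.coord_apply, exteriorPower.basis_coord, exteriorPower.ιMulti_family,
    exteriorPower.ιMultiDual_apply_ιMulti, ← Matrix.det_transpose]
  congr 1
  ext i j
  simp

lemma compd_star {n k : ℕ} (X : Matrix (Fin n) (Fin n) ℂ) : compd k (star X) = star (compd k X) := by
  ext s t
  rw [Matrix.star_apply, compd_apply, compd_apply, ← Matrix.det_conjTranspose]
  rfl

lemma compd_diagonal {n k : ℕ} (d : Fin n → ℂ) : compd k (diagonal d) = diagonal fun s => ∏ i ∈ s.val, d i := by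
  ext s t
  rw [compd_apply]
  by_cases hst : s = t
  · subst hst
    rw [Matrix.diagonal_apply_eq, Matrix.submatrix_diagonal _ _ (Set.powersetCard.ofFinEmbEquiv.symm s).injective,
      Matrix.det_diagonal]
    conv_rhs => rw [← Finset.image_orderEmbOfFin_univ s.val s.prop]
    rw [Finset.prod_image fun _ _ _ _ h => (Finset.orderEmbOfFin s.val s.prop).injective h]
    rfl
  · rw [Matrix.diagonal_apply_ne _ hst]
    obtain ⟨i, his, hit⟩ := (Set.powersetCard.exists_mem_notMem_iff_ne s t).mp hst
    obtain ⟨l, rfl⟩ := (Set.powersetCard.mem_range_ofFinEmbEquiv_symm_iff_mem s i).mpr his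
    apply Matrix.det_eq_zero_of_row_eq_zero l
    intro j
    rw [Matrix.submatrix_apply, Matrix.diagonal_apply_ne]
    intro h
    apply hit
    rw [h]
    exact (Set.powersetCard.mem_range_ofFinEmbEquiv_symm_iff_mem t _).mp ⟨j, rfl⟩

end mat

section op2
variable {𝒜 : Type*} [CStarAlgebra 𝒜] [PartialOrder 𝒜] [StarOrderedRing 𝒜]

lemma aux_smul {B : 𝒜} (hB : IsStrictlyPositive B) {c : ℝ} (hc : 0 < c) (s : ℝ) :
    (c • B) ^ s = c ^ s • B ^ s := by
  have hn : 0 ≤ c • B := smul_nonneg hc.le hB.nonneg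
  rw [CFC.rpow_eq_cfc_real hn, CFC.rpow_eq_cfc_real hB.nonneg]
  have h0 : ∀ x ∈ spectrum ℝ B, 0 < x := fun x hx => hB.spectrum_pos hx
  have hco : ContinuousOn (fun x : ℝ => x ^ s) (spectrum ℝ B) := by
    intro x hx
    exact (Real.continuousAt_rpow_const _ _ (Or.inl (h0 x hx).ne')).continuousWithinAt
  have hsa : IsSelfAdjoint B := IsSelfAdjoint.of_nonneg hB.nonneg
  rw [← cfc_smul (c ^ s) (fun x : ℝ => x ^ s) B hco, ← cfc_comp_smul c (fun x : ℝ => x ^ s) B ?_ hsa]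
  · apply cfc_congr
    intro x hx
    simp [Real.mul_rpow hc.le (h0 x hx).le]
  · rintro _ ⟨x, hx, rfl⟩
    refine (Real.continuousAt_rpow_const _ _ (Or.inl ?_)).continuousWithinAt
    have := h0 x hx
    simp only [smul_eq_mul]
    positivity

lemma op_two1 {A B : 𝒜} (hA : IsStrictlyPositive A) (hB : IsStrictlyPositive B) {r s : ℝ}
    (hr : 0 ≤ r) (hr1 : r ≤ 1) (hs : 1 ≤ s)
    (h : A ^ ((r + s) / 2) * B ^ s * A ^ ((r + s) / 2) ≤ 1) :
    A ^ (r / 2) * (A ^ (1/2 : ℝ) * B * A ^ (1/2 : ℝ)) ^ s * A ^ (r / 2) ≤ 1 := by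
  have hC : IsStrictlyPositive (A ^ (-1 : ℝ)) := IsStrictlyPositive.rpow A _ hA
  have hCp : ∀ x : ℝ, x ≠ 0 → (A ^ (-1 : ℝ)) ^ x = A ^ (-x) := by
    intro x hx
    rw [CFC.rpow_rpow A _ _ (by norm_num) hA]
    congr 1; ring
  have h1 := aux_conj hA (-((r + s) / 2)) h
  have e : A ^ (-((r + s) / 2)) * (A ^ ((r + s) / 2) * B ^ s * A ^ ((r + s) / 2)) * A ^ (-((r + s) / 2)) = B ^ s := by
    calc _ = (A ^ (-((r + s) / 2)) * A ^ ((r + s) / 2)) * B ^ s * (A ^ ((r + s) / 2) * A ^ (-((r + s) / 2))) := by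
          simp only [mul_assoc]
      _ = _ := by rw [CFC.rpow_neg_mul_rpow _ hA, CFC.rpow_mul_rpow_neg _ hA, one_mul, mul_one]
  rw [e, mul_one, ← CFC.rpow_add hA.isUnit, show -((r + s) / 2) + -((r + s) / 2) = -(r+s) by ring,
    ← hCp (r + s) (by linarith)] at h1
  have h2 := op_main hC hB hr hr1 hs h1
  rw [hCp _ (by norm_num), neg_neg] at h2
  have h3 : (A ^ (-1 : ℝ)) ^ r = A ^ (-r) := by
    by_cases hr0 : r = 0
    · subst hr0; rw [neg_zero, CFC.rpow_zero _ hC.nonneg, CFC.rpow_zero _ hA.nonneg]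
    · exact hCp r hr0
  rw [h3] at h2
  refine (aux_conj hA (r / 2) h2).trans (le_of_eq ?_)
  rw [← CFC.rpow_add hA.isUnit, ← CFC.rpow_add hA.isUnit, show r / 2 + -r + r / 2 = 0 by ring, CFC.rpow_zero _ hA.nonneg]

lemma op_two {A B : 𝒜} (hA : IsStrictlyPositive A) (hB : IsStrictlyPositive B) {r s M : ℝ}
    (hr : 0 ≤ r) (hr1 : r ≤ 1) (hs : 1 ≤ s) (hM : 0 < M)
    (h : A ^ ((r + s) / 2) * B ^ s * A ^ ((r + s) / 2) ≤ M • 1) :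
    A ^ (r / 2) * (A ^ (1/2 : ℝ) * B * A ^ (1/2 : ℝ)) ^ s * A ^ (r / 2) ≤ M • 1 := by
  have hs0 : 0 < s := by linarith
  set c : ℝ := M ^ (-(1/s)) with hc
  have hc0 : 0 < c := by positivity
  have hcs : c ^ s = M⁻¹ := by
    rw [hc, ← Real.rpow_mul hM.le, show -(1/s) * s = -1 by field_simp, Real.rpow_neg_one]
  have hcB : IsStrictlyPositive (c • B) := hB.smul hc0
  have hMM : ∀ X : 𝒜, M⁻¹ • X ≤ 1 ↔ X ≤ M • 1 := by
    intro X
    exact inv_smul_le_iff_of_pos hM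
  have := op_two1 hA hcB hr hr1 hs (by
    rw [aux_smul hB hc0, hcs, mul_smul_comm, smul_mul_assoc, hMM]; exact h)
  rw [mul_smul_comm, smul_mul_assoc, aux_smul (aux_sp hA hB _) hc0, hcs, mul_smul_comm, smul_mul_assoc, hMM] at this
  exact this
end op2

section mat2
open scoped ComplexOrder MatrixOrder Matrix.Norms.L2Operator
open Matrix

lemma spec_aeval {ι : Type*} [Fintype ι] [DecidableEq ι] (U : Matrix ι ι ℂ) (hU : star U * U = 1)
    (hU' : U * star U = 1) (d : ι → ℝ) (q : Polynomial ℝ) :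
    Polynomial.aeval (U * diagonal (fun i => (d i : ℂ)) * star U) q =
      U * diagonal (fun i => ((q.eval (d i) : ℝ) : ℂ)) * star U := by
  induction q using Polynomial.induction_on' with
  | add p q hp hq =>
    rw [map_add, hp, hq, ← add_mul, ← mul_add, diagonal_add]
    simp
  | monomial n a =>
    rw [Polynomial.aeval_monomial]
    have : (U * diagonal (fun i => (d i : ℂ)) * star U) ^ n = U * diagonal (fun i => (d i : ℂ) ^ n) * star U := by
      induction n with
      | zero => simp [hU']
      | succ n ih =>
        rw [pow_succ, ih]
        calc _ = U * diagonal (fun i => (d i : ℂ) ^ n) * (star U * U) * diagonal (fun i => (d i : ℂ)) * star U := by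
              simp only [mul_assoc]
          _ = _ := by rw [hU, mul_one, mul_assoc U, diagonal_mul_diagonal]; simp only [pow_succ]
    rw [this, ← Algebra.smul_def, ← smul_mul_assoc, ← mul_smul_comm]
    congr 2
    ext i j
    by_cases h : i = j
    · subst h; simp
    · simp [h]

lemma spec_cfc {ι : Type*} [Fintype ι] [DecidableEq ι] (U : Matrix ι ι ℂ) (hU : star U * U = 1)
    (hU' : U * star U = 1) (d : ι → ℝ) (f : ℝ → ℝ) :
    cfc f (U * diagonal (fun i => (d i : ℂ)) * star U) =
      U * diagonal (fun i => (f (d i) : ℂ)) * star U := by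
  classical
  set X := U * diagonal (fun i => (d i : ℂ)) * star U with hX
  have hsa : IsSelfAdjoint X := by
    rw [IsSelfAdjoint, hX, star_mul, star_mul, star_star, mul_assoc, star_eq_conjTranspose (diagonal _), diagonal_conjTranspose]
    congr 3
    ext i
    simp
  have hfin : (spectrum ℝ X).Finite := Matrix.finite_real_spectrum
  let S : Finset ℝ := hfin.toFinset ∪ Finset.univ.image d
  let q := Lagrange.interpolate S id f
  have hq : ∀ x ∈ S, q.eval x = f x := fun x hx =>
    Lagrange.eval_interpolate_at_node f (Function.injective_id.injOn) hx
  have h1 : cfc f X = cfc q.eval X := by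
    apply cfc_congr
    intro x hx
    exact (hq x (by simp [S, hx])).symm
  rw [h1, cfc_polynomial q X hsa, hX, spec_aeval U hU hU']
  congr 3
  ext i
  rw [hq _ (by simp [S])]

lemma spec_rpow {ι : Type*} [Fintype ι] [DecidableEq ι] (U : Matrix ι ι ℂ) (hU : star U * U = 1)
    (hU' : U * star U = 1) (d : ι → ℝ) (hd : ∀ i, 0 ≤ d i) (s : ℝ) :
    (U * diagonal (fun i => (d i : ℂ)) * star U) ^ s =
      U * diagonal (fun i => ((d i ^ s : ℝ) : ℂ)) * star U := by
  have : 0 ≤ U * diagonal (fun i => (d i : ℂ)) * star U := by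
    apply star_right_conjugate_nonneg
    rw [Matrix.nonneg_iff_posSemidef]
    exact PosSemidef.diagonal (fun i => by simpa using hd i)
  rw [CFC.rpow_eq_cfc_real this, spec_cfc U hU hU']

lemma spec_exists {n : ℕ} {X : Matrix (Fin n) (Fin n) ℂ} (hX : IsStrictlyPositive X) :
    ∃ (U : Matrix (Fin n) (Fin n) ℂ) (d : Fin n → ℝ), star U * U = 1 ∧ U * star U = 1 ∧ (∀ i, 0 < d i) ∧ X = U * diagonal (fun i => ((d i : ℝ) : ℂ)) * star U := by
  have hp : X.PosDef := Matrix.isStrictlyPositive_iff_posDef.1 hX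
  refine ⟨hp.1.eigenvectorUnitary, hp.1.eigenvalues, Unitary.coe_star_mul_self _, Unitary.coe_mul_star_self _, hp.eigenvalues_pos, ?_⟩
  conv_lhs => rw [hp.1.spectral_theorem]
  rfl

lemma spec_compd {n k : ℕ} (U : Matrix (Fin n) (Fin n) ℂ) (d : Fin n → ℝ) :
    compd k (U * diagonal (fun i => (d i : ℂ)) * star U) =
    compd k U * diagonal (fun S => ((∏ i ∈ S.val, d i : ℝ) : ℂ)) * star (compd k U) := by
  rw [compd_mul, compd_mul, compd_diagonal, compd_star]
  push_cast
  rfl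

lemma compd_unit {n k : ℕ} {U V : Matrix (Fin n) (Fin n) ℂ} (h : U * V = 1) : compd k U * compd k V = 1 := by
  rw [← compd_mul, h, compd_one]

lemma compd_rpow {n k : ℕ} {X : Matrix (Fin n) (Fin n) ℂ} (hX : IsStrictlyPositive X) (s : ℝ) :
    compd k (X ^ s) = compd k X ^ s := by
  obtain ⟨U, d, h1, h2, hd, rfl⟩ := spec_exists hX
  rw [spec_rpow U h1 h2 d (fun i => (hd i).le), spec_compd, spec_compd, spec_rpow]
  · congr 3
    ext S
    rw [Real.finsetProd_rpow _ _ fun i _ => (hd i).le]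
  · rw [← compd_star, compd_unit h1]
  · rw [← compd_star, compd_unit h2]
  · exact fun S => Finset.prod_nonneg fun i _ => (hd i).le

lemma compd_sp {n k : ℕ} {X : Matrix (Fin n) (Fin n) ℂ} (hX : IsStrictlyPositive X) :
    IsStrictlyPositive (compd k X) := by
  obtain ⟨U, d, h1, h2, hd, hh⟩ := spec_exists hX
  refine (IsStrictlyPositive.iff_of_unital).2 ⟨?_, ?_⟩
  · rw [hh, spec_compd]
    apply star_right_conjugate_nonneg
    rw [Matrix.nonneg_iff_posSemidef]
    refine PosSemidef.diagonal (fun i => ?_)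
    simp only [Pi.zero_apply, Complex.zero_le_real]
    exact Finset.prod_nonneg fun i _ => (hd i).le
  · obtain ⟨⟨u, v, h, h'⟩, rfl⟩ := hX.isUnit
    exact ⟨⟨compd k u, compd k v, compd_unit h, compd_unit h'⟩, rfl⟩

lemma spec_le {ι : Type*} [Fintype ι] [DecidableEq ι] (U : Matrix ι ι ℂ) (hU : star U * U = 1)
    (hU' : U * star U = 1) (d : ι → ℝ) (M : ℝ) :
    U * diagonal (fun i => (d i : ℂ)) * star U ≤ M • 1 ↔ ∀ i, d i ≤ M := by
  have e : (M • 1 : Matrix ι ι ℂ) = U * diagonal (fun _ => (M : ℂ)) * star U := by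
    have : diagonal (fun _ : ι => (M : ℂ)) = M • 1 := by
      ext i j
      by_cases h : i = j
      · subst h; simp
      · simp [h]
    rw [this]; simp [hU']
  have h0 : ∀ i, d i ≤ M ↔ (0 : ℂ) ≤ ((M : ℂ) - (d i : ℂ)) := by
    intro i
    rw [sub_nonneg]; simp
  rw [e]
  constructor
  · intro h
    have h2 := star_right_conjugate_le_conjugate h (star U)
    have e2 : ∀ D, star U * (U * D * star U) * star (star U) = D := by
      intro D
      calc _ = (star U * U) * D * (star U * U) := by simp only [mul_assoc, star_star]
        _ = D := by rw [hU]; simp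
    rw [e2, e2, ← sub_nonneg, Matrix.nonneg_iff_posSemidef, diagonal_sub, posSemidef_diagonal_iff] at h2
    intro i
    rw [h0]; exact h2 i
  · intro h
    apply star_right_conjugate_le_conjugate
    rw [← sub_nonneg, Matrix.nonneg_iff_posSemidef, diagonal_sub, posSemidef_diagonal_iff]
    intro i
    exact (h0 i).1 (h i)

lemma spec_trace {ι : Type*} [Fintype ι] [DecidableEq ι] (U : Matrix ι ι ℂ) (hU : star U * U = 1)
    (d : ι → ℝ) : (trace (U * diagonal (fun i => (d i : ℂ)) * star U)).re = ∑ i, d i := by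
  rw [Matrix.trace_mul_comm, ← mul_assoc, hU, one_mul, trace_diagonal]
  simp

lemma pd_case {n : ℕ} {A B : Matrix (Fin n) (Fin n) ℂ} (hA : IsStrictlyPositive A) (hB : IsStrictlyPositive B)
    {r s : ℝ} (hr : 0 ≤ r) (hr1 : r ≤ 1) (hs : 1 ≤ s) :
    (trace (A ^ r * (A ^ (1/2 : ℝ) * B * A ^ (1/2 : ℝ)) ^ s)).re ≤ (trace (A ^ (r + s) * B ^ s)).re := by
  have hT := aux_sp hA hB (1/2)
  have hX := aux_sp hA (IsStrictlyPositive.rpow _ s hT) (r/2)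
  have hY := aux_sp hA (IsStrictlyPositive.rpow _ s hB) ((r+s)/2)
  have e1 : trace (A ^ r * (A ^ (1/2 : ℝ) * B * A ^ (1/2 : ℝ)) ^ s) =
      trace (A ^ (r/2) * (A ^ (1/2 : ℝ) * B * A ^ (1/2 : ℝ)) ^ s * A ^ (r/2)) := by
    rw [trace_mul_comm _ (A ^ (r/2)), ← mul_assoc, ← CFC.rpow_add hA.isUnit, add_halves]
  have e2 : trace (A ^ (r + s) * B ^ s) = trace (A ^ ((r+s)/2) * B ^ s * A ^ ((r+s)/2)) := by
    rw [trace_mul_comm _ (A ^ ((r+s)/2)), ← mul_assoc, ← CFC.rpow_add hA.isUnit, add_halves]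
  rw [e1, e2]
  obtain ⟨U, x, hU, hU', hx, hXe⟩ := spec_exists hX
  obtain ⟨V, y, hV, hV', hy, hYe⟩ := spec_exists hY
  rw [hXe, hYe, spec_trace U hU, spec_trace V hV]
  apply num4 x y hx hy
  intro k M h S hS
  have hM : 0 < M := (Finset.prod_pos fun i _ => hy i).trans_le (h S hS)
  have cY : compd k (A ^ ((r+s)/2) * B ^ s * A ^ ((r+s)/2)) ≤ M • 1 := by
    rw [hYe, spec_compd, spec_le]
    · exact fun S => h S.val S.prop
    · rw [← compd_star, compd_unit hV]
    · rw [← compd_star, compd_unit hV']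
  simp only [compd_mul, compd_rpow hA, compd_rpow hB] at cY
  have cX := op_two (compd_sp (k := k) hA) (compd_sp (k := k) hB) hr hr1 hs hM cY
  rw [← compd_rpow hA, ← compd_rpow hA, ← compd_mul, ← compd_mul, ← compd_rpow hT, ← compd_mul, ← compd_mul,
    hXe, spec_compd, spec_le] at cX
  · exact cX ⟨S, hS⟩
  · rw [← compd_star, compd_unit hU]
  · rw [← compd_star, compd_unit hU']
end mat2

section mat3
open scoped ComplexOrder MatrixOrder Matrix.Norms.L2Operator
open Matrix

lemma tend_rpow {n : ℕ} {l : Filter ℝ} {F : ℝ → Matrix (Fin n) (Fin n) ℂ} {X : Matrix (Fin n) (Fin n) ℂ}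
    (hF : Filter.Tendsto F l (nhds X)) (h0 : ∀ᶠ e in l, 0 ≤ F e) (hX : 0 ≤ X) {s : ℝ} (hs : 0 ≤ s) :
    Filter.Tendsto (fun e => F e ^ s) l (nhds (X ^ s)) := by
  rcases hs.eq_or_lt with rfl | hs
  · rw [CFC.rpow_zero X hX]
    refine tendsto_const_nhds.congr' ?_
    filter_upwards [h0] with e he
    rw [CFC.rpow_zero _ he]
  · have hs' : (0 : NNReal) < ⟨s, hs.le⟩ := hs
    have h := CFC.continuousOn_nnrpow (A := Matrix (Fin n) (Fin n) ℂ) ⟨s, hs.le⟩ X hX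
    have h2 := h.tendsto.comp (tendsto_nhdsWithin_iff.2 ⟨hF, h0⟩)
    rw [CFC.nnrpow_eq_rpow hs'] at h2
    refine h2.congr ?_
    intro e
    exact CFC.nnrpow_eq_rpow hs'

lemma psd_case {n : ℕ} {A B : Matrix (Fin n) (Fin n) ℂ} (hA : 0 ≤ A) (hB : 0 ≤ B)
    {r s : ℝ} (hr : 0 ≤ r) (hr1 : r ≤ 1) (hs : 1 ≤ s) :
    (trace (A ^ r * (A ^ (1/2 : ℝ) * B * A ^ (1/2 : ℝ)) ^ s)).re ≤ (trace (A ^ (r + s) * B ^ s)).re := by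
  let l : Filter ℝ := nhdsWithin 0 (Set.Ioi 0)
  have hs0 : 0 ≤ s := by linarith
  have hpos : ∀ᶠ e in l, (0 : ℝ) < e := self_mem_nhdsWithin
  have hsp : ∀ (X : Matrix (Fin n) (Fin n) ℂ), 0 ≤ X → ∀ e : ℝ, 0 < e → IsStrictlyPositive (X + e • 1) := by
    intro X hX e he
    rw [Matrix.isStrictlyPositive_iff_posDef]
    exact PosDef.posSemidef_add (Matrix.nonneg_iff_posSemidef.1 hX) (PosDef.one.smul he)
  have ht : ∀ (X : Matrix (Fin n) (Fin n) ℂ), Filter.Tendsto (fun e : ℝ => X + e • 1) l (nhds X) := by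
    intro X
    have : Continuous (fun e : ℝ => X + e • (1 : Matrix (Fin n) (Fin n) ℂ)) := by fun_prop
    have := (this.tendsto 0).mono_left (nhdsWithin_le_nhds (s := Set.Ioi 0))
    simpa using this
  have hn : ∀ (X : Matrix (Fin n) (Fin n) ℂ), 0 ≤ X → ∀ᶠ e in l, 0 ≤ X + e • (1 : Matrix (Fin n) (Fin n) ℂ) := by
    intro X hX
    filter_upwards [hpos] with e he using (hsp X hX e he).nonneg
  have hR : ∀ {X : Matrix (Fin n) (Fin n) ℂ}, 0 ≤ X → ∀ {t : ℝ}, 0 ≤ t →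
      Filter.Tendsto (fun e : ℝ => (X + e • (1 : Matrix (Fin n) (Fin n) ℂ)) ^ t) l (nhds (X ^ t)) :=
    fun {X} hX {t} h => tend_rpow (ht X) (hn X hX) hX h
  have htr : Continuous fun X : Matrix (Fin n) (Fin n) ℂ => (trace X).re :=
    Complex.continuous_re.comp (Continuous.matrix_trace continuous_id)
  have hh := hR hA (t := 1/2) (by norm_num)
  have L1 := tend_rpow ((hh.mul (ht B)).mul hh) (by
    filter_upwards [hpos] with e he
    exact (aux_sp (hsp A hA e he) (hsp B hB e he) (1/2)).nonneg)
    (conjugate_nonneg_of_nonneg hB CFC.rpow_nonneg) hs0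
  have R1 := (htr.tendsto _).comp ((hR hA hr).mul L1)
  have R2 := (htr.tendsto _).comp ((hR hA (t := r + s) (by linarith)).mul (hR hB hs0))
  refine le_of_tendsto_of_tendsto R1 R2 ?_
  filter_upwards [hpos] with e he
  exact pd_case (hsp A hA e he) (hsp B hB e he) hr hr1 hs

lemma mpow_eq {n : ℕ} {A : Matrix (Fin n) (Fin n) ℂ} (hA : 0 ≤ A) (s : ℝ) : mpow A s = A ^ s := by
  rw [CFC.rpow_eq_cfc_real hA]; rfl

lemma bridge {n : ℕ} (A B : Matrix (Fin n) (Fin n) ℂ)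
    (hA : A.PosSemidef) (hB : B.PosSemidef)
    (p q r : ℝ) (hr : 0 ≤ r) (hrp : r ≤ p) (hpq : p ≤ q) (hp : 0 < p) :
    (Matrix.trace (mpow A r * mpow (mpow A (p/2) * mpow B p * mpow A (p/2)) (q/p))).re ≤
      (Matrix.trace (mpow A (r + q) * mpow B q)).re := by
  rw [← Matrix.nonneg_iff_posSemidef] at hA hB
  simp only [mpow_eq hA, mpow_eq hB]
  rw [mpow_eq (conjugate_nonneg_of_nonneg CFC.rpow_nonneg CFC.rpow_nonneg)]
  have h := psd_case (A := A ^ p) (B := B ^ p) CFC.rpow_nonneg CFC.rpow_nonneg (r := r / p) (s := q / p)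
    (by positivity) (by rwa [div_le_one hp]) (by rwa [one_le_div hp])
  have hq : 0 ≤ q := by linarith
  rw [CFC.rpow_rpow_of_exponent_nonneg A _ _ hp.le (by positivity) hA,
    CFC.rpow_rpow_of_exponent_nonneg A _ _ hp.le (by positivity) hA,
    CFC.rpow_rpow_of_exponent_nonneg A _ _ hp.le (by positivity) hA,
    CFC.rpow_rpow_of_exponent_nonneg B _ _ hp.le (by positivity) hB,
    show p * (r / p) = r by field_simp, show p * (r / p + q / p) = r + q by field_simp,
    show p * (q / p) = q by field_simp, show p * (1/2) = p / 2 by ring] at h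
  exact h
end mat3

/-- GBLP trace inequality (reversed direction): for `A, B` positive semidefinite,
`0 ≤ r ≤ p ≤ q` and `p > 0`:
`Tr[A^r (A^{p/2} B^p A^{p/2})^{q/p}] ≤ Tr[A^{r+q} B^q]` (as real parts). -/
theorem stmt_13 {n : ℕ} (A B : Matrix (Fin n) (Fin n) ℂ)
    (hA : A.PosSemidef) (hB : B.PosSemidef)
    (p q r : ℝ) (hr : 0 ≤ r) (hrp : r ≤ p) (hpq : p ≤ q) (hp : 0 < p) :
    (Matrix.trace (mpow A r * mpow (mpow A (p/2) * mpow B p * mpow A (p/2)) (q/p))).re ≤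
      (Matrix.trace (mpow A (r + q) * mpow B q)).re := by
  exact bridge A B hA hB p q r hr hrp hpq hp
end

section
/- (Matharu–Aujla trace inequality, direct direction.) Let A be an n×n complex positive definite matrix and B an n×n complex positive semidefinite matrix. Then for every s ∈ [0,1] ∪ [2,∞): Tr[A · (A^{-1/2} B A^{-1/2})^s] ≤ Tr[A^{1-s} · B^s]. (Both traces are real; equivalently the inequality holds between their real parts.) -/
open scoped ComplexOrder

namespace MA

open Matrix Complex

variable {n : ℕ}

/-- Squared Hilbert–Schmidt norm. -/
noncomputable def hs (M : Matrix (Fin n) (Fin n) ℂ) : ℝ := ∑ i, ∑ j, ‖M i j‖ ^ 2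

/-- Real diagonal matrix. -/
noncomputable def dg (f : Fin n → ℝ) : Matrix (Fin n) (Fin n) ℂ := diagonal fun i => (f i : ℂ)

lemma hs_nonneg (M : Matrix (Fin n) (Fin n) ℂ) : 0 ≤ hs M := by
  unfold hs; positivity

lemma hs_eq (M : Matrix (Fin n) (Fin n) ℂ) : ((hs M : ℝ) : ℂ) = trace (Mᴴ * M) := by
  simp only [hs, trace, mul_apply, diag_apply, conjTranspose_apply, ofReal_sum, ofReal_pow]
  rw [Finset.sum_comm]
  refine Finset.sum_congr rfl fun i _ => Finset.sum_congr rfl fun j _ => ?_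
  rw [← Complex.conj_mul']; rfl

lemma hs_conjTranspose (M : Matrix (Fin n) (Fin n) ℂ) : hs Mᴴ = hs M := by
  simp only [hs, conjTranspose_apply, norm_star]
  rw [Finset.sum_comm]

lemma hs_unitary_mul (U M : Matrix (Fin n) (Fin n) ℂ) (hU : Uᴴ * U = 1) : hs (U * M) = hs M := by
  have : ((hs (U * M) : ℝ) : ℂ) = (hs M : ℝ) := by
    rw [hs_eq, hs_eq, conjTranspose_mul, Matrix.mul_assoc, ← Matrix.mul_assoc Uᴴ, hU,
      Matrix.one_mul]
  exact_mod_cast this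

lemma hs_mul_unitary (U M : Matrix (Fin n) (Fin n) ℂ) (hU : U * Uᴴ = 1) : hs (M * U) = hs M := by
  rw [← hs_conjTranspose, conjTranspose_mul, hs_unitary_mul, hs_conjTranspose]
  simpa using hU

lemma hs_diag_mul_le (d : Fin n → ℂ) (hd : ∀ i, ‖d i‖ ≤ 1) (M : Matrix (Fin n) (Fin n) ℂ) :
    hs (diagonal d * M) ≤ hs M := by
  unfold hs
  refine Finset.sum_le_sum fun i _ => Finset.sum_le_sum fun j _ => ?_
  rw [diagonal_mul, norm_mul]
  have := mul_le_mul_of_nonneg_right (hd i) (norm_nonneg (M i j))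
  rw [one_mul] at this
  gcongr

lemma hs_diag_diag (d e : Fin n → ℂ) (M : Matrix (Fin n) (Fin n) ℂ) :
    hs (diagonal d * M * diagonal e) = ∑ i, ∑ j, ‖d i‖ ^ 2 * ‖M i j‖ ^ 2 * ‖e j‖ ^ 2 := by
  simp [hs, mul_diagonal, diagonal_mul, mul_pow]

lemma norm_trace_mul_le (M N : Matrix (Fin n) (Fin n) ℂ) :
    ‖trace (M * N)‖ ≤ √(hs M) * √(hs N) := by
  have h1 : ‖trace (M * N)‖ ≤ ∑ p : Fin n × Fin n, ‖M p.1 p.2‖ * ‖N p.2 p.1‖ := by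
    rw [trace, Fintype.sum_prod_type]
    simp only [diag_apply, mul_apply]
    refine (norm_sum_le _ _).trans (Finset.sum_le_sum fun i _ => (norm_sum_le _ _).trans ?_)
    simp
  refine h1.trans ((Real.sum_mul_le_sqrt_mul_sqrt _ _ _).trans (le_of_eq ?_))
  congr 2
  · rw [Fintype.sum_prod_type]; rfl
  · rw [Fintype.sum_prod_type, Finset.sum_comm]; rfl

/-- Complex power with value `0` at base `0`. -/
noncomputable def ex (x : ℝ) (w : ℂ) : ℂ := if x = 0 then 0 else cexp (w * (Real.log x : ℝ))

lemma ex_add (x : ℝ) (w w' : ℂ) : ex x (w + w') = ex x w * ex x w' := by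
  unfold ex; split_ifs <;> simp [add_mul, Complex.exp_add]

lemma norm_ex {x : ℝ} (hx : 0 < x) (w : ℂ) : ‖ex x w‖ = x ^ w.re := by
  rw [ex, if_neg hx.ne', Complex.norm_exp, Real.rpow_def_of_pos hx]
  simp [mul_comm]

lemma norm_ex' {x : ℝ} (hx : 0 ≤ x) (w : ℂ) (hw : w.re ≠ 0) : ‖ex x w‖ = x ^ w.re := by
  rcases hx.eq_or_lt with rfl | h
  · simp [ex, Real.zero_rpow hw]
  · exact norm_ex h w

lemma norm_ex_sq {x : ℝ} (hx : 0 ≤ x) (w : ℂ) (hw : w.re ≠ 0) : ‖ex x w‖ ^ 2 = x ^ (2 * w.re) := by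
  rw [norm_ex' hx w hw, mul_comm, Real.rpow_mul hx, Real.rpow_two]

lemma norm_ex_le_one {x : ℝ} (hx : 0 ≤ x) (w : ℂ) (hw : w.re = 0) : ‖ex x w‖ ≤ 1 := by
  rcases hx.eq_or_lt with rfl | h
  · simp [ex]
  · rw [norm_ex h, hw, Real.rpow_zero]

lemma ex_ofReal {x : ℝ} (hx : 0 ≤ x) (r : ℝ) (hr : r ≠ 0) : ex x (r : ℂ) = ((x ^ r : ℝ) : ℂ) := by
  rcases hx.eq_or_lt with rfl | h
  · simp [ex, Real.zero_rpow hr]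
  · rw [ex, if_neg h.ne', Real.rpow_def_of_pos h, mul_comm]
    push_cast; rfl

lemma ex_diff (x : ℝ) (c d : ℂ) : Differentiable ℂ fun z => ex x (c + d * z) := by
  unfold ex
  split_ifs
  · exact differentiable_const _
  · fun_prop

/-- Boundedness on the closed strip. -/
def Bd (f : ℂ → ℂ) : Prop :=
  ∃ C : ℝ, ∀ z ∈ HadamardThreeLines.verticalClosedStrip 0 (1/2), ‖f z‖ ≤ C

lemma Bd.mul {f g : ℂ → ℂ} (hf : Bd f) (hg : Bd g) : Bd fun z => f z * g z := by
  obtain ⟨C, hC⟩ := hf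
  obtain ⟨D, hD⟩ := hg
  refine ⟨C * D, fun z hz => ?_⟩
  rw [norm_mul]
  exact mul_le_mul (hC z hz) (hD z hz) (norm_nonneg _) ((norm_nonneg _).trans (hC z hz))

lemma Bd.const (c : ℂ) : Bd fun _ => c := ⟨‖c‖, fun _ _ => le_rfl⟩

lemma Bd.sum {f : Fin n → ℂ → ℂ} (hf : ∀ i, Bd (f i)) : Bd fun z => ∑ i, f i z := by
  choose C hC using hf
  exact ⟨∑ i, C i, fun z hz => (norm_sum_le _ _).trans (Finset.sum_le_sum fun i _ => hC i z hz)⟩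

lemma Bd_ex (x c d : ℝ) : Bd fun z => ex x ((c : ℂ) + (d : ℂ) * z) := by
  by_cases hx : x = 0
  · exact ⟨0, fun z _ => by simp [ex, hx]⟩
  · refine ⟨Real.exp ((|c| + |d| * (1/2)) * |Real.log x|), fun z hz => ?_⟩
    simp only [HadamardThreeLines.verticalClosedStrip, Set.mem_preimage, Set.mem_Icc] at hz
    simp only [ex, if_neg hx, Complex.norm_exp]
    simp only [mul_re, add_re, ofReal_re, ofReal_im, mul_zero, sub_zero, zero_mul]
    refine Real.exp_le_exp.2 ((le_abs_self _).trans ?_)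
    rw [abs_mul]
    gcongr
    refine (abs_add_le _ _).trans ?_
    rw [abs_mul, abs_of_nonneg hz.1]
    gcongr
    exact hz.2

lemma sum_form (u v w : Fin n → ℂ) (M N K : Matrix (Fin n) (Fin n) ℂ) :
    trace (diagonal u * M * diagonal v * N * diagonal w * K) =
      ∑ i, ∑ j, ∑ k, u i * M i k * v k * N k j * w j * K j i := by
  rw [trace]
  refine Finset.sum_congr rfl fun i _ => ?_
  rw [diag_apply, mul_apply]
  refine Finset.sum_congr rfl fun j _ => ?_
  rw [mul_diagonal, mul_apply, Finset.sum_mul, Finset.sum_mul]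
  refine Finset.sum_congr rfl fun k _ => ?_
  rw [mul_diagonal, diagonal_mul]

lemma trace_dg (f g : Fin n → ℝ) (P : Matrix (Fin n) (Fin n) ℂ) :
    trace (dg f * P * dg g * Pᴴ) = ((∑ i, ∑ k, f i * g k * ‖P i k‖ ^ 2 : ℝ) : ℂ) := by
  rw [trace]
  push_cast
  refine Finset.sum_congr rfl fun i _ => ?_
  rw [diag_apply, mul_apply]
  refine Finset.sum_congr rfl fun j _ => ?_
  rw [dg, dg, mul_diagonal, diagonal_mul, conjTranspose_apply, ← Complex.mul_conj']
  simp only [RCLike.star_def]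
  ring

lemma dg_mul (f g : Fin n → ℝ) : (dg f * dg g : Matrix (Fin n) (Fin n) ℂ) = dg fun i => f i * g i := by
  simp [dg, diagonal_mul_diagonal]

lemma dg_one : (dg fun _ => 1 : Matrix (Fin n) (Fin n) ℂ) = 1 := by simp [dg]

lemma dg_conj (f : Fin n → ℝ) : (dg f)ᴴ = dg f := by
  simp [dg, diagonal_conjTranspose, Pi.star_def]

/-- The case `s ≥ 2` through the three lines theorem. -/
lemma core_two (a b x : Fin n → ℝ) (ha : ∀ i, 0 < a i) (hb : ∀ i, 0 ≤ b i) (hx : ∀ i, 0 ≤ x i)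
    (P Q : Matrix (Fin n) (Fin n) ℂ) (hP : Pᴴ * P = 1) (hP' : P * Pᴴ = 1)
    (hQ : Qᴴ * Q = 1) (hQ' : Q * Qᴴ = 1)
    (hrel : Q * dg b * Qᴴ = dg (fun i => √(a i)) * P * dg x * Pᴴ * dg (fun i => √(a i)))
    (s : ℝ) (h2s : 2 ≤ s) :
    ∑ i, ∑ k, a i * x k ^ s * ‖P i k‖ ^ 2 ≤ ∑ i, ∑ j, a i ^ (1 - s) * b j ^ s * ‖Q i j‖ ^ 2 := by
  set L := ∑ i, ∑ k, a i * x k ^ s * ‖P i k‖ ^ 2 with hL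
  set R := ∑ i, ∑ j, a i ^ (1 - s) * b j ^ s * ‖Q i j‖ ^ 2 with hR
  have hs0 : 0 < s := by linarith
  have hR0 : 0 ≤ R := Finset.sum_nonneg fun i _ => Finset.sum_nonneg fun j _ =>
    mul_nonneg (mul_nonneg (Real.rpow_nonneg (ha i).le _) (Real.rpow_nonneg (hb j) _)) (by positivity)
  have hL0 : 0 ≤ L := Finset.sum_nonneg fun i _ => Finset.sum_nonneg fun j _ =>
    mul_nonneg (mul_nonneg (ha i).le (Real.rpow_nonneg (hx j) _)) (by positivity)
  let Eb : ℂ → Fin n → ℂ := fun z j => ex (b j) (((0 : ℝ) : ℂ) + (s : ℂ) * z)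
  let Ea : ℂ → Fin n → ℂ := fun z i => ex (a i) (((1/2 : ℝ) : ℂ) + ((-s : ℝ) : ℂ) * z)
  let Ex : ℂ → Fin n → ℂ := fun z k => ex (x k) ((s : ℂ) + ((-s : ℝ) : ℂ) * z)
  let Es : Fin n → ℂ := fun i => ex (a i) ((1/2 : ℝ) : ℂ)
  let K : Matrix (Fin n) (Fin n) ℂ := Pᴴ * diagonal Es * Q
  let F : ℂ → ℂ := fun z =>
    trace (diagonal (Eb z) * Qᴴ * diagonal (Ea z) * P * diagonal (Ex z) * K)
  have hEs : diagonal Es = dg (fun i => √(a i)) := by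
    unfold dg; congr 1; funext i
    simp only [Es]
    rw [ex_ofReal (ha i).le _ (by norm_num), Real.sqrt_eq_rpow]
  have hEs2 : ∀ i, ‖Es i‖ ^ 2 = a i := fun i => by
    simp only [Es]
    rw [norm_ex_sq (ha i).le _ (by rw [ofReal_re]; norm_num), ofReal_re]; norm_num
  have hF : ∀ z, F z = ∑ i, ∑ j, ∑ k, Eb z i * Qᴴ i k * Ea z k * P k j * Ex z j * K j i :=
    fun z => sum_form _ _ _ _ _ _
  have hdiff : Differentiable ℂ F := by
    have h1 : ∀ i, Differentiable ℂ fun z => Eb z i := fun i => ex_diff _ _ _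
    have h2 : ∀ i, Differentiable ℂ fun z => Ea z i := fun i => ex_diff _ _ _
    have h3 : ∀ i, Differentiable ℂ fun z => Ex z i := fun i => ex_diff _ _ _
    rw [funext hF]
    refine Differentiable.fun_sum fun i _ => Differentiable.fun_sum fun j _ =>
      Differentiable.fun_sum fun k _ => ?_
    have := h1 i
    have := h2 k
    have := h3 j
    fun_prop
  have hbd : Bd F := by
    rw [funext hF]
    exact Bd.sum fun i => Bd.sum fun j => Bd.sum fun k =>
      (((((Bd_ex _ _ _).mul (Bd.const _)).mul (Bd_ex _ _ _)).mul (Bd.const _)).mul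
        (Bd_ex _ _ _)).mul (Bd.const _)
  have hKhs : ∀ e : Fin n → ℂ, (∀ k, ‖e k‖ ^ 2 = x k ^ s) → hs (diagonal e * K) = L := by
    intro e he
    have : diagonal e * K = (diagonal e * Pᴴ * diagonal Es) * Q := by
      simp only [K, Matrix.mul_assoc]
    rw [this, hs_mul_unitary _ _ hQ', hs_diag_diag, hL, Finset.sum_comm]
    refine Finset.sum_congr rfl fun i _ => Finset.sum_congr rfl fun j _ => ?_
    rw [he, hEs2, conjTranspose_apply, norm_star]; ring
  have hbound0 : ∀ z ∈ re ⁻¹' {(0 : ℝ)}, ‖F z‖ ≤ L := by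
    intro z hz
    have hz : z.re = 0 := hz
    let e1 : Fin n → ℂ := fun k => ex (x k) (((s/2 : ℝ) : ℂ) + ((-s : ℝ) : ℂ) * z)
    let e2 : Fin n → ℂ := fun k => ex (x k) ((s/2 : ℝ) : ℂ)
    have hsplit : diagonal (Ex z) = diagonal e1 * diagonal e2 := by
      rw [diagonal_mul_diagonal]; congr 1; funext k
      simp only [Ex, e1, e2]
      rw [← ex_add]; congr 1; push_cast; ring
    have h1 : F z = trace ((diagonal (Eb z) * (Qᴴ * (diagonal (Ea z) * P * diagonal e1))) *
        (diagonal e2 * K)) := by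
      simp only [F, hsplit, Matrix.mul_assoc]
    rw [h1]
    refine (norm_trace_mul_le _ _).trans ?_
    have h2 : hs (diagonal e2 * K) = L := hKhs _ fun k => by
      simp only [e2]
      rw [norm_ex_sq (hx k) _ (by rw [ofReal_re]; positivity), ofReal_re]; congr 1; ring
    have h3 : hs (diagonal (Eb z) * (Qᴴ * (diagonal (Ea z) * P * diagonal e1))) ≤ L := by
      refine (hs_diag_mul_le _ (fun i => norm_ex_le_one (hb i) _ (by simp [hz])) _).trans ?_
      rw [hs_unitary_mul _ _ (by simpa using hQ'), hs_diag_diag, hL]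
      refine le_of_eq (Finset.sum_congr rfl fun i _ => Finset.sum_congr rfl fun j _ => ?_)
      simp only [Ea, e1]
      have r1 : ((((1/2 : ℝ) : ℂ) + ((-s : ℝ) : ℂ) * z)).re = 1/2 := by
        rw [add_re, re_ofReal_mul, ofReal_re, hz]; ring
      have r2 : ((((s/2 : ℝ) : ℂ) + ((-s : ℝ) : ℂ) * z)).re = s/2 := by
        rw [add_re, re_ofReal_mul, ofReal_re, hz]; ring
      rw [norm_ex_sq (ha i).le _ (by rw [r1]; norm_num), norm_ex_sq (hx j) _ (by rw [r2]; positivity),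
        r1, r2]
      rw [show 2 * (1/2 : ℝ) = 1 by norm_num, Real.rpow_one, show 2 * (s/2) = s by ring]
      ring
    rw [h2]
    calc _ ≤ √L * √L := by gcongr
      _ = L := Real.mul_self_sqrt hL0
  have hbound1 : ∀ z ∈ re ⁻¹' {(1/2 : ℝ)}, ‖F z‖ ≤ √R * √L := by
    intro z hz
    have hz : z.re = 1/2 := hz
    have h1 : F z = trace ((diagonal (Eb z) * Qᴴ * diagonal (Ea z)) *
        (P * (diagonal (Ex z) * K))) := by
      simp only [F, Matrix.mul_assoc]
    rw [h1]
    refine (norm_trace_mul_le _ _).trans (le_of_eq ?_)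
    have r1 : ((((1/2 : ℝ) : ℂ) + ((-s : ℝ) : ℂ) * z)).re = (1 - s)/2 := by
      rw [add_re, re_ofReal_mul, ofReal_re, hz]; ring
    have r2 : (((s : ℂ) + ((-s : ℝ) : ℂ) * z)).re = s/2 := by
      rw [add_re, re_ofReal_mul, ofReal_re, hz]; ring
    have r3 : (((((0 : ℝ) : ℂ)) + (s : ℂ) * z)).re = s/2 := by
      rw [add_re, re_ofReal_mul, ofReal_re, hz]; ring
    congr 2
    · rw [hs_diag_diag, hR, Finset.sum_comm]
      refine (Finset.sum_congr rfl fun i _ => Finset.sum_congr rfl fun j _ => ?_)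
      simp only [Ea, Eb]
      rw [norm_ex_sq (ha i).le _ (by rw [r1]; apply ne_of_lt; linarith),
        norm_ex_sq (hb j) _ (by rw [r3]; positivity), r1, r3, conjTranspose_apply, norm_star,
        show 2 * ((1 - s)/2) = 1 - s by ring, show 2 * (s/2) = s by ring]
      ring
    · rw [hs_unitary_mul _ _ hP]
      refine hKhs _ fun k => ?_
      simp only [Ex]
      rw [norm_ex_sq (hx k) _ (by rw [r2]; positivity), r2, show 2 * (s/2) = s by ring]
  have hval : F ((1 / s : ℝ) : ℂ) = (L : ℂ) := by
    have e1 : diagonal (Eb ((1 / s : ℝ) : ℂ)) = dg b := by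
      unfold dg; congr 1; funext j
      simp only [Eb]
      rw [← ofReal_mul, ← ofReal_add, show 0 + s * (1 / s) = 1 by field_simp; ring,
        ex_ofReal (hb j) _ one_ne_zero, Real.rpow_one]
    have e2 : diagonal (Ea ((1 / s : ℝ) : ℂ)) = dg (fun i => (√(a i))⁻¹) := by
      unfold dg; congr 1; funext i
      simp only [Ea]
      rw [← ofReal_mul, ← ofReal_add, show 1/2 + -s * (1 / s) = -(1/2) by field_simp; ring,
        ex_ofReal (ha i).le _ (by norm_num), Real.rpow_neg (ha i).le, Real.sqrt_eq_rpow]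
    have e3 : diagonal (Ex ((1 / s : ℝ) : ℂ)) = dg (fun k => x k ^ (s - 1)) := by
      unfold dg; congr 1; funext i
      simp only [Ex]
      rw [← ofReal_mul, ← ofReal_add, show s + -s * (1 / s) = s - 1 by field_simp; ring,
        ex_ofReal (hx i) _ (by apply ne_of_gt; linarith)]
    have e4 : (dg (fun i => √(a i)) * dg (fun i => (√(a i))⁻¹) : Matrix (Fin n) (Fin n) ℂ) = 1 := by
      rw [dg_mul, ← dg_one]; congr 1; funext i
      exact mul_inv_cancel₀ (Real.sqrt_pos.2 (ha i)).ne'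
    have e5 : (dg x * dg (fun k => x k ^ (s - 1)) : Matrix (Fin n) (Fin n) ℂ)
        = dg fun k => x k ^ s := by
      rw [dg_mul]; congr 1; funext k
      rcases (hx k).eq_or_lt with h | h
      · rw [← h, Real.zero_rpow hs0.ne', zero_mul]
      · conv_lhs => rw [← Real.rpow_one (x k), ← Real.rpow_mul h.le, ← Real.rpow_add h]
        congr 1; ring
    have e6 : (dg (fun i => √(a i)) * dg (fun i => √(a i)) : Matrix (Fin n) (Fin n) ℂ) = dg a := by
      rw [dg_mul]; congr 1; funext i; exact Real.mul_self_sqrt (ha i).le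
    have : F ((1 / s : ℝ) : ℂ) = trace ((Q * dg b * Qᴴ) * dg (fun i => (√(a i))⁻¹) * P *
        dg (fun k => x k ^ (s - 1)) * Pᴴ * dg (fun i => √(a i))) := by
      simp only [F, e1, e2, e3, K, hEs]
      rw [← Matrix.mul_assoc, ← Matrix.mul_assoc, Matrix.trace_mul_comm]
      simp only [Matrix.mul_assoc]
    rw [this, hrel]
    have : dg (fun i => √(a i)) * P * dg x * Pᴴ * dg (fun i => √(a i)) *
        dg (fun i => (√(a i))⁻¹) * P * dg (fun k => x k ^ (s - 1)) * Pᴴ * dg (fun i => √(a i))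
        = dg (fun i => √(a i)) * (P * (dg x * ((Pᴴ * ((dg (fun i => √(a i)) *
        dg (fun i => (√(a i))⁻¹)) * P)) * dg (fun k => x k ^ (s - 1)))) * Pᴴ * dg (fun i => √(a i))) := by
      simp only [Matrix.mul_assoc]
    rw [this, e4, Matrix.one_mul, hP, Matrix.one_mul, e5, Matrix.trace_mul_comm]
    rw [show P * dg (fun k => x k ^ s) * Pᴴ * dg (fun i => √(a i)) * dg (fun i => √(a i)) =
      P * dg (fun k => x k ^ s) * Pᴴ * (dg (fun i => √(a i)) * dg (fun i => √(a i))) by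
      simp only [Matrix.mul_assoc], e6, Matrix.trace_mul_comm, ← Matrix.mul_assoc,
      ← Matrix.mul_assoc, trace_dg]
  have hmem : ((1 / s : ℝ) : ℂ) ∈ HadamardThreeLines.verticalClosedStrip 0 (1/2) := by
    simp only [HadamardThreeLines.verticalClosedStrip, Set.mem_preimage, Set.mem_Icc, ofReal_re]
    exact ⟨by positivity, one_div_le_one_div_of_le (by norm_num) h2s⟩
  have hbd' : BddAbove ((norm ∘ F) '' HadamardThreeLines.verticalClosedStrip 0 (1/2)) := by
    obtain ⟨C, hC⟩ := hbd
    refine ⟨C, ?_⟩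
    rintro _ ⟨z, hz, rfl⟩
    exact hC z hz
  have key := HadamardThreeLines.norm_le_interp_of_mem_verticalClosedStrip' (f := F)
    (by norm_num : (0 : ℝ) < 1/2) hmem hdiff.diffContOnCl hbd' hbound0 hbound1
  rw [hval, ofReal_re, norm_real, Real.norm_of_nonneg hL0] at key
  by_contra! hlt
  have hLp : 0 < L := hR0.trans_lt hlt
  have hθ : 0 < (1 / s - 0) / (1 / 2 - 0) := by
    have : 0 < 1 / s := by positivity
    simp only [sub_zero]; positivity
  have h1 : √R * √L < L := by
    calc √R * √L < √L * √L := by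
          have := Real.sqrt_lt_sqrt hR0 hlt
          have := Real.sqrt_pos.2 hLp
          gcongr
      _ = L := Real.mul_self_sqrt hL0
  have h2 := Real.rpow_lt_rpow (by positivity) h1 hθ
  have h3 := mul_lt_mul_of_pos_left h2
    (Real.rpow_pos_of_pos hLp (1 - (1 / s - 0) / (1 / 2 - 0)))
  rw [← Real.rpow_add hLp, sub_add_cancel, Real.rpow_one] at h3
  linarith

lemma stieltjes (a b x : Fin n → ℝ) (ha : ∀ i, 0 < a i) (hb : ∀ i, 0 ≤ b i) (hx : ∀ i, 0 ≤ x i)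
    (P Q : Matrix (Fin n) (Fin n) ℂ) (hP' : P * Pᴴ = 1)
    (hQ : Qᴴ * Q = 1)
    (hrel : Q * dg b * Qᴴ = dg (fun i => √(a i)) * P * dg x * Pᴴ * dg (fun i => √(a i)))
    (t : ℝ) (ht : 0 < t) :
    ∑ i, ∑ j, a i * (t + b j / a i)⁻¹ * ‖Q i j‖ ^ 2 ≤ ∑ i, ∑ k, a i * (t + x k)⁻¹ * ‖P i k‖ ^ 2 := by
  set S := ∑ i, ∑ j, a i * (t + b j / a i)⁻¹ * ‖Q i j‖ ^ 2 with hS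
  set T := ∑ i, ∑ k, a i * (t + x k)⁻¹ * ‖P i k‖ ^ 2 with hT
  have hpos : ∀ i j, 0 < t + b j / a i := fun i j =>
    add_pos_of_pos_of_nonneg ht (div_nonneg (hb j) (ha i).le)
  have hxpos : ∀ k, 0 < t + x k := fun k => add_pos_of_pos_of_nonneg ht (hx k)
  let Y : Matrix (Fin n) (Fin n) ℂ :=
    Matrix.of fun j i => star (Q i j) * (((t + b j / a i)⁻¹ : ℝ) : ℂ)
  have hY : ∀ i j, ‖Y j i‖ ^ 2 = ‖Q i j‖ ^ 2 * ((t + b j / a i)⁻¹) ^ 2 := by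
    intro i j
    simp only [Y, of_apply, norm_mul, norm_star, mul_pow, norm_real, Real.norm_eq_abs, sq_abs]
  set K : Matrix (Fin n) (Fin n) ℂ := dg (fun i => √(a i)) * P with hK
  have hKc : Kᴴ = Pᴴ * dg (fun i => √(a i)) := by rw [hK, conjTranspose_mul, dg_conj]
  have e6 : (dg (fun i => √(a i)) * dg (fun i => √(a i)) : Matrix (Fin n) (Fin n) ℂ) = dg a := by
    rw [dg_mul]; congr 1; funext i; exact Real.mul_self_sqrt (ha i).le
  have hKK : K * Kᴴ = dg a := by
    rw [hKc, hK, Matrix.mul_assoc, ← Matrix.mul_assoc P, hP', Matrix.one_mul, e6]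
  have hKx : K * (dg x * Kᴴ) = Q * (dg b * Qᴴ) := by
    rw [hKc]; simp only [Matrix.mul_assoc] at hrel ⊢; exact hrel.symm
  let e : Fin n → ℝ := fun k => (t + x k)⁻¹
  let Z : Matrix (Fin n) (Fin n) ℂ := Q * Y
  have hZc : Zᴴ = Yᴴ * Qᴴ := conjTranspose_mul _ _
  let N1 := Zᴴ * K - K * dg e
  let N2 := Z * K - K * dg e
  have n1 : 0 ≤ (trace (N1 * (dg x * N1ᴴ))).re := by
    have := trace_dg (fun _ => 1) x N1
    rw [dg_one, Matrix.one_mul, Matrix.mul_assoc] at this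
    rw [this, ofReal_re]
    exact Finset.sum_nonneg fun i _ => Finset.sum_nonneg fun j _ =>
      mul_nonneg (mul_nonneg zero_le_one (hx j)) (by positivity)
  have n2 : 0 ≤ (trace (N2 * N2ᴴ)).re := by
    have := hs_eq N2ᴴ
    rw [conjTranspose_conjTranspose] at this
    rw [← this, ofReal_re]; exact hs_nonneg _
  have hN1 : N1ᴴ = Kᴴ * Z - dg e * Kᴴ := by
    simp only [N1, conjTranspose_sub, conjTranspose_mul, dg_conj, conjTranspose_conjTranspose]
  have hN2 : N2ᴴ = Kᴴ * Zᴴ - dg e * Kᴴ := by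
    simp only [N2, conjTranspose_sub, conjTranspose_mul, dg_conj]
  have t1 : trace (N1 * (dg x * N1ᴴ)) = trace (Zᴴ * ((K * (dg x * Kᴴ)) * Z))
      - trace (Zᴴ * (K * ((dg x * dg e) * Kᴴ))) - trace (K * ((dg e * dg x) * Kᴴ) * Z)
      + trace (K * ((dg e * dg x * dg e) * Kᴴ)) := by
    rw [hN1]
    simp only [N1, Matrix.mul_sub, Matrix.sub_mul, Matrix.mul_assoc, trace_sub]
    ring
  have t2 : trace (N2 * N2ᴴ) = trace (Z * ((K * Kᴴ) * Zᴴ))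
      - trace (K * (dg e * Kᴴ) * Z) - trace (Zᴴ * (K * (dg e * Kᴴ)))
      + trace (K * ((dg e * dg e) * Kᴴ)) := by
    rw [hN2]
    rw [Matrix.trace_mul_comm (K * (dg e * Kᴴ)) Z, Matrix.trace_mul_comm Zᴴ]
    simp only [N2, Matrix.mul_sub, Matrix.sub_mul, Matrix.mul_assoc, trace_sub]
    ring
  have hlin : dg e * dg x + (t : ℂ) • dg e = 1 := by
    rw [← dg_one, dg_mul]
    ext i j
    by_cases hij : i = j
    · subst hij
      simp only [dg, Matrix.add_apply, Matrix.smul_apply, diagonal_apply_eq, smul_eq_mul, e]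
      rw [← ofReal_mul, ← ofReal_add]
      congr 1
      have := (hxpos i).ne'
      field_simp
      ring
    · simp [dg, diagonal_apply_ne _ hij]
  have hlin' : dg x * dg e + (t : ℂ) • dg e = 1 := by
    rw [← hlin, dg_mul, dg_mul]; simp only [mul_comm]
  have hlin2 : dg e * dg x * dg e + (t : ℂ) • (dg e * dg e) = dg e := by
    rw [← Matrix.smul_mul, ← Matrix.add_mul, hlin, Matrix.one_mul]
  have sm : ∀ M : Matrix (Fin n) (Fin n) ℂ, (t : ℂ) * trace M = trace ((t : ℂ) • M) := fun M => by
    rw [trace_smul, smul_eq_mul]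
  have c1 : trace (Zᴴ * (K * ((dg x * dg e) * Kᴴ))) + (t : ℂ) * trace (Zᴴ * (K * (dg e * Kᴴ)))
      = trace (Zᴴ * dg a) := by
    rw [sm, ← trace_add, ← Matrix.mul_smul, ← Matrix.mul_add,
      ← Matrix.mul_smul, ← Matrix.mul_add, ← Matrix.smul_mul, ← Matrix.add_mul, hlin',
      Matrix.one_mul, hKK]
  have c2 : trace (K * ((dg e * dg x) * Kᴴ) * Z) + (t : ℂ) * trace (K * (dg e * Kᴴ) * Z)
      = trace (dg a * Z) := by
    rw [sm, ← trace_add, ← Matrix.smul_mul, ← Matrix.add_mul,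
      ← Matrix.mul_smul, ← Matrix.mul_add, ← Matrix.smul_mul, ← Matrix.add_mul, hlin,
      Matrix.one_mul, hKK]
  have c3 : trace (K * ((dg e * dg x * dg e) * Kᴴ)) + (t : ℂ) * trace (K * ((dg e * dg e) * Kᴴ))
      = (T : ℂ) := by
    rw [sm, ← trace_add,
      ← Matrix.mul_smul, ← Matrix.mul_add, ← Matrix.smul_mul, ← Matrix.add_mul, hlin2, hKc, hK,
      ← trace_dg, ← e6, Matrix.mul_assoc, Matrix.trace_mul_comm]
    conv_rhs => rw [Matrix.mul_assoc, Matrix.mul_assoc, Matrix.mul_assoc, Matrix.trace_mul_comm]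
    simp only [Matrix.mul_assoc, e]
    rw [Matrix.trace_mul_comm (dg fun i => √(a i))]
    simp only [Matrix.mul_assoc]
  have c4 : trace (Zᴴ * ((K * (dg x * Kᴴ)) * Z)) + (t : ℂ) * trace (Z * ((K * Kᴴ) * Zᴴ))
      = (S : ℂ) := by
    have h1 : trace (Zᴴ * ((K * (dg x * Kᴴ)) * Z)) = trace (dg b * Y * dg (fun _ => 1) * Yᴴ) := by
      rw [hKx, hZc, dg_one]
      simp only [Z]
      rw [show Yᴴ * Qᴴ * (Q * (dg b * Qᴴ) * (Q * Y)) = Yᴴ * ((Qᴴ * Q) * (dg b * ((Qᴴ * Q) * Y))) by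
        simp only [Matrix.mul_assoc], hQ, Matrix.one_mul, Matrix.one_mul, Matrix.mul_one,
        Matrix.trace_mul_comm]
    have h2 : trace (Z * ((K * Kᴴ) * Zᴴ)) = trace (dg (fun _ => 1) * Y * dg a * Yᴴ) := by
      rw [hKK, hZc, dg_one]
      simp only [Z]
      rw [show Q * Y * (dg a * (Yᴴ * Qᴴ)) = Q * (Y * dg a * Yᴴ * Qᴴ) by
        simp only [Matrix.mul_assoc], Matrix.trace_mul_comm, Matrix.mul_assoc _ Qᴴ, hQ,
        Matrix.mul_one, Matrix.one_mul]
    rw [h1, h2, trace_dg, trace_dg, ← ofReal_mul, ← ofReal_add]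
    congr 1
    rw [hS, Finset.mul_sum, ← Finset.sum_add_distrib]
    simp only [Finset.mul_sum, ← Finset.sum_add_distrib]
    conv_rhs => rw [Finset.sum_comm]
    refine Finset.sum_congr rfl fun j _ => Finset.sum_congr rfl fun i _ => ?_
    rw [hY]
    have h3 := (hpos i j).ne'
    have h4 := (ha i).ne'
    have h5 : b j = a i * (b j / a i) := by field_simp
    have h6 : (t + b j / a i) * (t + b j / a i)⁻¹ = 1 := mul_inv_cancel₀ h3
    generalize (t + b j / a i)⁻¹ = u at *
    generalize b j / a i = v at *
    rw [h5]
    linear_combination (a i * u * ‖Q i j‖ ^ 2) * h6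
  have c5 : trace (dg a * Z) = (S : ℂ) := by
    simp only [Z]
    rw [← Matrix.mul_assoc, trace, hS]
    push_cast
    refine Finset.sum_congr rfl fun i _ => ?_
    rw [diag_apply, mul_apply]
    refine Finset.sum_congr rfl fun j _ => ?_
    rw [dg, diagonal_mul, ← Complex.mul_conj']
    simp only [Y, of_apply, RCLike.star_def]
    push_cast
    ring
  have c6 : trace (Zᴴ * dg a) = (S : ℂ) := by
    have : Zᴴ * dg a = (dg a * Z)ᴴ := by rw [conjTranspose_mul (dg a) Z, dg_conj]
    rw [this, trace_conjTranspose, c5]; simp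
  have total : trace (N1 * (dg x * N1ᴴ)) + (t : ℂ) * trace (N2 * N2ᴴ) = ((T - S : ℝ) : ℂ) := by
    rw [t1, t2]
    push_cast
    rw [c6] at c1
    rw [c5] at c2
    linear_combination c4 - c1 - c2 + c3
  have := congrArg re total
  rw [add_re, re_ofReal_mul, ofReal_re] at this
  have := mul_nonneg ht.le n2
  linarith

lemma row_sum (Q : Matrix (Fin n) (Fin n) ℂ) (hQ' : Q * Qᴴ = 1) (i : Fin n) :
    ∑ j, ‖Q i j‖ ^ 2 = 1 := by
  have := congrFun (congrFun hQ' i) i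
  rw [mul_apply, one_apply_eq] at this
  have h2 : ((∑ j, ‖Q i j‖ ^ 2 : ℝ) : ℂ) = 1 := by
    rw [← this]; push_cast
    refine Finset.sum_congr rfl fun j _ => ?_
    rw [← Complex.mul_conj']; rfl
  exact_mod_cast h2

open MeasureTheory Set in
lemma core_one (a b x : Fin n → ℝ) (ha : ∀ i, 0 < a i) (hb : ∀ i, 0 ≤ b i) (hx : ∀ i, 0 ≤ x i)
    (P Q : Matrix (Fin n) (Fin n) ℂ) (hP' : P * Pᴴ = 1)
    (hQ : Qᴴ * Q = 1) (hQ' : Q * Qᴴ = 1)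
    (hrel : Q * dg b * Qᴴ = dg (fun i => √(a i)) * P * dg x * Pᴴ * dg (fun i => √(a i)))
    (s : ℝ) (hs : s ∈ Icc (0 : ℝ) 1) :
    ∑ i, ∑ k, a i * x k ^ s * ‖P i k‖ ^ 2 ≤ ∑ i, ∑ j, a i ^ (1 - s) * b j ^ s * ‖Q i j‖ ^ 2 := by
  rcases hs.1.eq_or_lt with rfl | h0
  · simp only [Real.rpow_zero, mul_one, sub_zero, Real.rpow_one, ← Finset.mul_sum,
      row_sum P hP', row_sum Q hQ', le_refl]
  rcases hs.2.eq_or_lt with rfl | h1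
  · have e6 : (dg (fun i => √(a i)) * dg (fun i => √(a i)) : Matrix (Fin n) (Fin n) ℂ) = dg a := by
      rw [dg_mul]; congr 1; funext i; exact Real.mul_self_sqrt (ha i).le
    have h1 := trace_dg (fun _ => 1) b Q
    have h2 := trace_dg a x P
    rw [dg_one, Matrix.one_mul, hrel, Matrix.trace_mul_comm] at h1
    rw [← e6] at h2
    simp only [Matrix.mul_assoc] at h1 h2
    rw [h1] at h2
    have h3 := Complex.ofReal_injective h2
    simp only [Real.rpow_one, sub_self, Real.rpow_zero]
    exact h3.symm.le
  have hp : s ∈ Ioo (0 : ℝ) 1 := ⟨h0, h1⟩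
  set c := ∫ t in Ioi 0, Real.rpowIntegrand₀₁ s t 1 with hc
  have hcpos : 0 < c := Real.integral_rpowIntegrand₀₁_one_pos hp
  have hba : ∀ i j, 0 ≤ b j / a i := fun i j => div_nonneg (hb j) (ha i).le
  have hR : ∀ i j, a i ^ (1 - s) * b j ^ s = a i * (b j / a i) ^ s := by
    intro i j
    rw [Real.div_rpow (hb j) (ha i).le, Real.rpow_sub (ha i), Real.rpow_one]
    ring
  simp only [hR]
  have gen : ∀ (w y : Fin n → Fin n → ℝ), (∀ i j, 0 ≤ y i j) →
      IntegrableOn (fun t => ∑ i, ∑ j, w i j * Real.rpowIntegrand₀₁ s t (y i j)) (Ioi 0) ∧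
      ∫ t in Ioi 0, ∑ i, ∑ j, w i j * Real.rpowIntegrand₀₁ s t (y i j) =
        (∑ i, ∑ j, w i j * (y i j) ^ s) * c := by
    intro w y hy
    have hi : ∀ i j, IntegrableOn (fun t => w i j * Real.rpowIntegrand₀₁ s t (y i j)) (Ioi 0) :=
      fun i j => (Real.integrableOn_rpowIntegrand₀₁_Ioi hp (hy i j)).const_mul _
    refine ⟨integrable_finsetSum _ fun i _ => integrable_finsetSum _ fun j _ => hi i j, ?_⟩
    rw [integral_finsetSum _ fun i _ => integrable_finsetSum _ fun j _ => hi i j, Finset.sum_mul]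
    refine Finset.sum_congr rfl fun i _ => ?_
    rw [integral_finsetSum _ fun j _ => hi i j, Finset.sum_mul]
    refine Finset.sum_congr rfl fun j _ => ?_
    rw [integral_const_mul, Real.integral_rpowIntegrand₀₁_eq_rpow_mul_const hp (hy i j), mul_assoc]
  obtain ⟨i1, q1⟩ := gen (fun i k => a i * ‖P i k‖ ^ 2) (fun _ k => x k) fun _ k => hx k
  obtain ⟨i2, q2⟩ := gen (fun i j => a i * ‖Q i j‖ ^ 2) (fun i j => b j / a i) hba
  have hmono := setIntegral_mono_on i1 i2 measurableSet_Ioi (fun t ht => by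
    have ht : 0 < t := ht
    have key := stieltjes a b x ha hb hx P Q hP' hQ hrel t ht
    have conv : ∀ (M : Matrix (Fin n) (Fin n) ℂ) (hM : M * Mᴴ = 1) (y : Fin n → Fin n → ℝ),
        ∑ i, ∑ j, a i * ‖M i j‖ ^ 2 * Real.rpowIntegrand₀₁ s t (y i j) =
          t ^ s * (t⁻¹ * ∑ i, a i - ∑ i, ∑ j, a i * (t + y i j)⁻¹ * ‖M i j‖ ^ 2) := by
      intro M hM y
      rw [Finset.mul_sum, ← Finset.sum_sub_distrib, Finset.mul_sum]
      refine Finset.sum_congr rfl fun i _ => ?_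
      rw [show t⁻¹ * a i = ∑ j, t⁻¹ * a i * ‖M i j‖ ^ 2 by
        rw [← Finset.mul_sum, row_sum M hM, mul_one], ← Finset.sum_sub_distrib, Finset.mul_sum]
      refine Finset.sum_congr rfl fun j _ => ?_
      rw [Real.rpowIntegrand₀₁]
      ring
    rw [conv P hP', conv Q hQ']
    gcongr)
  rw [q1, q2] at hmono
  have := le_of_mul_le_mul_right hmono hcpos
  calc _ = ∑ i, ∑ k, a i * ‖P i k‖ ^ 2 * x k ^ s :=
        Finset.sum_congr rfl fun i _ => Finset.sum_congr rfl fun j _ => by ring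
    _ ≤ _ := this
    _ = _ := Finset.sum_congr rfl fun i _ => Finset.sum_congr rfl fun j _ => by ring

end MA

open Matrix in
lemma MA.spec {n : ℕ} (A : Matrix (Fin n) (Fin n) ℂ) (hA : A.IsHermitian) :
    ∃ (U : Matrix (Fin n) (Fin n) ℂ), Uᴴ * U = 1 ∧ U * Uᴴ = 1 ∧
      A = U * MA.dg hA.eigenvalues * Uᴴ ∧
      ∀ f : ℝ → ℝ, cfc f A = U * MA.dg (fun i => f (hA.eigenvalues i)) * Uᴴ := by
  refine ⟨hA.eigenvectorUnitary, ?_, ?_, ?_, fun f => ?_⟩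
  · exact Unitary.coe_star_mul_self hA.eigenvectorUnitary
  · exact Unitary.coe_mul_star_self hA.eigenvectorUnitary
  · exact hA.spectral_theorem
  · rw [hA.cfc_eq]; rfl

open Matrix in
theorem stmt_14 {n : ℕ} (A B : Matrix (Fin n) (Fin n) ℂ)
    (hA : A.PosDef) (hB : B.PosSemidef)
    (s : ℝ) (hs : s ∈ Set.Icc (0 : ℝ) 1 ∪ Set.Ici (2 : ℝ)) :
    (Matrix.trace (A * mpow (mpow A (-(1/2)) * B * mpow A (-(1/2))) s)).re ≤
      (Matrix.trace (mpow A (1 - s) * mpow B s)).re := by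
  obtain ⟨U, hU, hU', hAU, hAf⟩ := MA.spec A hA.1
  obtain ⟨V, hV, hV', hBV, hBf⟩ := MA.spec B hB.1
  set a := hA.1.eigenvalues with ha_def
  set b := hB.1.eigenvalues with hb_def
  have ha : ∀ i, 0 < a i := hA.eigenvalues_pos
  have hb : ∀ i, 0 ≤ b i := hB.eigenvalues_nonneg
  set G := mpow A (-(1/2)) with hG
  have hGe : G = U * MA.dg (fun i => a i ^ (-(1/2) : ℝ)) * Uᴴ := hAf _
  have hGh : Gᴴ = G := by
    rw [hGe]; simp only [conjTranspose_mul, conjTranspose_conjTranspose, MA.dg_conj,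
      Matrix.mul_assoc]
  have hX : (G * B * G).PosSemidef := by
    have := hB.mul_mul_conjTranspose_same G
    rwa [hGh] at this
  obtain ⟨W, hW, hW', hXW, hXf⟩ := MA.spec (G * B * G) hX.1
  set x := hX.1.eigenvalues with hx_def
  have hx : ∀ i, 0 ≤ x i := hX.eigenvalues_nonneg
  have uni : ∀ M N : Matrix (Fin n) (Fin n) ℂ, M * Mᴴ = 1 → Nᴴ * N = 1 →
      (Mᴴ * N)ᴴ * (Mᴴ * N) = 1 := by
    intro M N h1 h2
    rw [conjTranspose_mul, conjTranspose_conjTranspose, Matrix.mul_assoc, ← Matrix.mul_assoc M,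
      h1, Matrix.one_mul, h2]
  have uni' : ∀ M N : Matrix (Fin n) (Fin n) ℂ, M * Mᴴ = 1 → Nᴴ * N = 1 →
      (Mᴴ * N) * (Mᴴ * N)ᴴ = 1 := fun M N h1 h2 => mul_eq_one_comm.1 (uni M N h1 h2)
  have hP := uni U W hU' hW
  have hP' := uni' U W hU' hW
  have hQ := uni U V hU' hV
  have hQ' := uni' U V hU' hV
  have canc : (MA.dg (fun i => √(a i)) * MA.dg (fun i => a i ^ (-(1/2) : ℝ)) :
      Matrix (Fin n) (Fin n) ℂ) = 1 := by
    rw [MA.dg_mul, ← MA.dg_one]; congr 1; funext i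
    rw [Real.sqrt_eq_rpow, ← Real.rpow_add (ha i)]; norm_num
  have canc' := mul_eq_one_comm.1 canc
  have hrel : (Uᴴ * V) * MA.dg b * (Uᴴ * V)ᴴ = MA.dg (fun i => √(a i)) * (Uᴴ * W) * MA.dg x *
      (Uᴴ * W)ᴴ * MA.dg (fun i => √(a i)) := by
    have h1 : (Uᴴ * V) * MA.dg b * (Uᴴ * V)ᴴ = Uᴴ * B * U := by
      rw [hBV]
      simp only [conjTranspose_mul, conjTranspose_conjTranspose, Matrix.mul_assoc]
    have h2 : MA.dg (fun i => √(a i)) * (Uᴴ * W) * MA.dg x *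
      (Uᴴ * W)ᴴ * MA.dg (fun i => √(a i)) = MA.dg (fun i => √(a i)) * Uᴴ * (G * B * G) * U *
        MA.dg (fun i => √(a i)) := by
      rw [hXW]
      simp only [conjTranspose_mul, conjTranspose_conjTranspose, Matrix.mul_assoc]
    rw [h1, h2, hGe]
    have : MA.dg (fun i => √(a i)) * Uᴴ * (U * MA.dg (fun i => a i ^ (-(1/2) : ℝ)) * Uᴴ * B *
        (U * MA.dg (fun i => a i ^ (-(1/2) : ℝ)) * Uᴴ)) * U * MA.dg (fun i => √(a i)) =
        MA.dg (fun i => √(a i)) * ((Uᴴ * U) * (MA.dg (fun i => a i ^ (-(1/2) : ℝ)) * (Uᴴ * B *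
        U * (MA.dg (fun i => a i ^ (-(1/2) : ℝ)) * ((Uᴴ * U) * MA.dg (fun i => √(a i))))))) := by
      simp only [Matrix.mul_assoc]
    rw [this, hU, Matrix.one_mul, Matrix.one_mul, canc', Matrix.mul_one, ← Matrix.mul_assoc, canc,
      Matrix.one_mul]
  have gen : ∀ (f g : Fin n → ℝ) (N : Matrix (Fin n) (Fin n) ℂ),
      (trace ((U * MA.dg f * Uᴴ) * (N * MA.dg g * Nᴴ))).re =
        ∑ i, ∑ k, f i * g k * ‖(Uᴴ * N) i k‖ ^ 2 := by
    intro f g N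
    have h1 := MA.trace_dg f g (Uᴴ * N)
    have h2 : trace ((U * MA.dg f * Uᴴ) * (N * MA.dg g * Nᴴ)) =
        trace (MA.dg f * (Uᴴ * N) * MA.dg g * (Uᴴ * N)ᴴ) := by
      rw [Matrix.mul_assoc U, Matrix.mul_assoc U, Matrix.trace_mul_comm]
      simp only [conjTranspose_mul, conjTranspose_conjTranspose, Matrix.mul_assoc]
    rw [h2, h1, Complex.ofReal_re]
  have hl : (trace (A * mpow (G * B * G) s)).re = ∑ i, ∑ k, a i * x k ^ s * ‖(Uᴴ * W) i k‖ ^ 2 := by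
    rw [mpow, hXf]
    conv_lhs => rw [hAU]
    exact gen _ _ _
  have hr : (trace (mpow A (1 - s) * mpow B s)).re =
      ∑ i, ∑ j, a i ^ (1 - s) * b j ^ s * ‖(Uᴴ * V) i j‖ ^ 2 := by
    rw [mpow, mpow, hAf, hBf]
    exact gen _ _ _
  rw [hl, hr]
  rcases hs with hs | hs
  · exact MA.core_one a b x ha hb hx _ _ hP' hQ hQ' hrel s hs
  · exact MA.core_two a b x ha hb hx _ _ hP hP' hQ hQ' hrel s hs
end

section
/- (Matharu–Aujla trace inequality, reversed direction.) Let A be an n×n complex positive definite matrix and B an n×n complex positive semidefinite matrix. Then for every s ∈ [1,2]: Tr[A^{1-s} · B^s] ≤ Tr[A · (A^{-1/2} B A^{-1/2})^s]. (Both traces are real; equivalently the inequality holds between their real parts.) -/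
open scoped ComplexOrder

open Matrix in
theorem aux_trace_diag {n : ℕ} (d : Fin n → ℝ) (P : Matrix (Fin n) (Fin n) ℂ) :
    (trace (diagonal (fun i => (d i : ℂ)) * P)).re = ∑ i, d i * (P i i).re := by
  simp [trace, diagonal_mul]

open Matrix in
theorem aux_gram {n : ℕ} (N : Matrix (Fin n) (Fin n) ℂ) (i : Fin n) :
    ((Nᴴ * N) i i).re = ∑ k, Complex.normSq (N k i) := by
  simp [Matrix.mul_apply, Complex.normSq_apply]

open Matrix in
theorem aux_gram_nonneg {n : ℕ} (N : Matrix (Fin n) (Fin n) ℂ) (i : Fin n) :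
    0 ≤ ((Nᴴ * N) i i).re := by
  rw [aux_gram]
  exact Finset.sum_nonneg fun k _ => Complex.normSq_nonneg _

open Matrix in
theorem aux_col {n : ℕ} (M X : Matrix (Fin n) (Fin n) ℂ) (c : ℝ) (i : Fin n) :
    2 * c * ((Mᴴ * X * M) i i).re - c ^ 2 * ((Mᴴ * M) i i).re ≤
      (((X * M)ᴴ * (X * M)) i i).re := by
  have h := aux_gram_nonneg (X * M - (c : ℂ) • M) i
  have e : (X * M - (c : ℂ) • M)ᴴ * (X * M - (c : ℂ) • M)
      = (X * M)ᴴ * (X * M) - (c : ℂ) • (Mᴴ * X * M) - (c : ℂ) • (Mᴴ * X * M)ᴴ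
        + ((c ^ 2 : ℝ) : ℂ) • (Mᴴ * M) := by
    simp only [conjTranspose_sub, conjTranspose_smul, conjTranspose_mul, conjTranspose_conjTranspose,
      Matrix.mul_sub, Matrix.sub_mul, Matrix.mul_smul, Matrix.smul_mul, smul_smul, Matrix.mul_assoc]
    simp only [Complex.star_def, Complex.conj_ofReal, Complex.ofReal_pow]
    module
  rw [e] at h
  simp only [Matrix.add_apply, Matrix.sub_apply, Matrix.smul_apply, smul_eq_mul, Complex.add_re,
    Complex.sub_re, Complex.re_ofReal_mul, conjTranspose_apply (Mᴴ * X * M), Complex.star_def,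
    Complex.conj_re] at h
  linarith

open Matrix in
theorem aux_key {n : ℕ} (M X : Matrix (Fin n) (Fin n) ℂ) (l : Fin n → ℝ) (hl : ∀ i, 0 ≤ l i)
    (t : ℝ) (ht : 0 < t) :
    2 * (trace (M * diagonal (fun i => (l i : ℂ)) * Mᴴ * X)).re
      - (trace (Xᴴ * (M * diagonal (fun i => (l i : ℂ)) * Mᴴ) * X)).re
      - t * (trace (X * (M * Mᴴ) * Xᴴ)).re
      ≤ ∑ i, l i * (l i / (t + l i)) * ((Mᴴ * M) i i).re := by
  have h1 : trace (M * diagonal (fun i => (l i : ℂ)) * Mᴴ * X)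
      = trace (diagonal (fun i => (l i : ℂ)) * (Mᴴ * X * M)) := by
    rw [Matrix.mul_assoc, Matrix.mul_assoc, trace_mul_comm]
    simp only [Matrix.mul_assoc]
  have h2 : trace (Xᴴ * (M * diagonal (fun i => (l i : ℂ)) * Mᴴ) * X)
      = trace (diagonal (fun i => (l i : ℂ)) * ((Xᴴ * M)ᴴ * (Xᴴ * M))) := by
    have : Xᴴ * (M * diagonal (fun i => (l i : ℂ)) * Mᴴ) * X =
      (Xᴴ * M) * (diagonal (fun i => (l i : ℂ)) * (Mᴴ * X)) := by simp only [Matrix.mul_assoc]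
    rw [this, trace_mul_comm]
    simp only [Matrix.mul_assoc, conjTranspose_mul, conjTranspose_conjTranspose]
  have h3 : trace (X * (M * Mᴴ) * Xᴴ) = trace ((X * M)ᴴ * (X * M)) := by
    have : X * (M * Mᴴ) * Xᴴ = (X * M) * (Mᴴ * Xᴴ) := by simp only [Matrix.mul_assoc]
    rw [this, trace_mul_comm, conjTranspose_mul]
  have h3' : (trace ((X * M)ᴴ * (X * M))).re = ∑ i, (((X * M)ᴴ * (X * M)) i i).re := by
    simp [trace]
  rw [h1, h2, h3, aux_trace_diag, aux_trace_diag, h3', Finset.mul_sum, Finset.mul_sum,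
    ← Finset.sum_sub_distrib, ← Finset.sum_sub_distrib]
  refine Finset.sum_le_sum fun i _ => ?_
  have a1 := aux_col M X (l i / (t + l i)) i
  have a2 := aux_col M Xᴴ (l i / (t + l i)) i
  have e : ((Mᴴ * Xᴴ * M) i i).re = ((Mᴴ * X * M) i i).re := by
    have : Mᴴ * Xᴴ * M = (Mᴴ * X * M)ᴴ := by
      simp only [Matrix.mul_assoc, conjTranspose_mul, conjTranspose_conjTranspose]
    rw [this, conjTranspose_apply, Complex.star_def, Complex.conj_re]
  rw [e] at a2
  have b1 := mul_le_mul_of_nonneg_left a1 ht.le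
  have b2 := mul_le_mul_of_nonneg_left a2 (hl i)
  have hc : (t + l i) * (l i / (t + l i)) = l i := by
    have := hl i
    field_simp
  generalize l i / (t + l i) = c at *
  generalize ((Mᴴ * X * M) i i).re = z at *
  generalize ((Mᴴ * M) i i).re = m at *
  have h4 : 2 * (l i * z) = 2 * ((t + l i) * c) * z := by rw [hc]; ring
  have h5 : l i * c * m = ((t + l i) * c) * c * m := by rw [hc]
  rw [h4, h5]
  linarith

open Matrix in
theorem aux_trace_two {n : ℕ} (Y : Matrix (Fin n) (Fin n) ℂ) (a b : Fin n → ℝ) :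
    (trace (diagonal (fun i => (b i : ℂ)) * (Y * diagonal (fun i => (a i : ℂ)) * Yᴴ))).re
      = ∑ k, ∑ j, b k * (a j * Complex.normSq (Y k j)) := by
  rw [aux_trace_diag]
  refine Finset.sum_congr rfl fun k _ => ?_
  rw [← Finset.mul_sum]
  congr 1
  rw [Matrix.mul_apply, Complex.re_sum]
  refine Finset.sum_congr rfl fun j _ => ?_
  rw [Matrix.mul_diagonal, conjTranspose_apply, Complex.star_def, mul_right_comm, Complex.mul_conj,
    mul_comm, ← Complex.ofReal_mul, Complex.ofReal_re]

open Matrix in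
theorem aux_step_s15 {n : ℕ} (U V M : Matrix (Fin n) (Fin n) ℂ) (α β l : Fin n → ℝ)
    (hU : Uᴴ * U = 1) (hV : Vᴴ * V = 1)
    (hα : ∀ i, 0 < α i) (hβ : ∀ i, 0 ≤ β i) (hl : ∀ i, 0 ≤ l i)
    (hA : U * diagonal (fun i => (α i : ℂ)) * Uᴴ = M * Mᴴ)
    (hB : V * diagonal (fun i => (β i : ℂ)) * Vᴴ = M * diagonal (fun i => (l i : ℂ)) * Mᴴ)
    (t : ℝ) (ht : 0 < t) :
    ∑ k, ∑ j, β k * (β k / (t * α j + β k)) * Complex.normSq ((Vᴴ * U) k j)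
      ≤ ∑ i, l i * (l i / (t + l i)) * ((Mᴴ * M) i i).re := by
  set G := Vᴴ * U with hG
  let Y : Matrix (Fin n) (Fin n) ℂ := of fun k j => ((β k / (t * α j + β k) : ℝ) : ℂ) * G k j
  have key := aux_key M (V * Y * Uᴴ) l hl t ht
  rw [← hA, ← hB] at key
  refine le_trans (le_of_eq ?_) key
  have h1 : trace (V * diagonal (fun i => (β i : ℂ)) * Vᴴ * (V * Y * Uᴴ))
      = trace (diagonal (fun i => (β i : ℂ)) * (Y * Gᴴ)) := by
    have : V * diagonal (fun i => (β i : ℂ)) * Vᴴ * (V * Y * Uᴴ)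
      = V * (diagonal (fun i => (β i : ℂ)) * ((Vᴴ * V) * Y * Uᴴ)) := by
      simp only [Matrix.mul_assoc]
    rw [this, hV, trace_mul_comm, Matrix.one_mul, hG]
    simp only [Matrix.mul_assoc, conjTranspose_mul, conjTranspose_conjTranspose]
  have h2 : trace ((V * Y * Uᴴ)ᴴ * (V * diagonal (fun i => (β i : ℂ)) * Vᴴ) * (V * Y * Uᴴ))
      = trace (diagonal (fun i => (β i : ℂ)) * (Y * diagonal (fun _ => ((1 : ℝ) : ℂ)) * Yᴴ)) := by
    have : (V * Y * Uᴴ)ᴴ * (V * diagonal (fun i => (β i : ℂ)) * Vᴴ) * (V * Y * Uᴴ)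
      = U * Yᴴ * ((Vᴴ * V) * (diagonal (fun i => (β i : ℂ)) * ((Vᴴ * V) * Y * Uᴴ))) := by
      simp only [Matrix.mul_assoc, conjTranspose_mul, conjTranspose_conjTranspose]
    rw [this, hV, trace_mul_comm, Matrix.one_mul, Matrix.one_mul]
    have : diagonal (fun i => (β i : ℂ)) * (Y * Uᴴ) * (U * Yᴴ)
      = diagonal (fun i => (β i : ℂ)) * (Y * (Uᴴ * U) * Yᴴ) := by simp only [Matrix.mul_assoc]
    rw [this, hU]
    simp
  have h3 : trace ((V * Y * Uᴴ) * (U * diagonal (fun i => (α i : ℂ)) * Uᴴ) * (V * Y * Uᴴ)ᴴ)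
      = trace (diagonal (fun _ => ((1 : ℝ) : ℂ)) * (Y * diagonal (fun i => (α i : ℂ)) * Yᴴ)) := by
    have : (V * Y * Uᴴ) * (U * diagonal (fun i => (α i : ℂ)) * Uᴴ) * (V * Y * Uᴴ)ᴴ
      = V * (Y * (Uᴴ * U) * (diagonal (fun i => (α i : ℂ)) * ((Uᴴ * U) * (Yᴴ * Vᴴ)))) := by
      simp only [Matrix.mul_assoc, conjTranspose_mul, conjTranspose_conjTranspose]
    rw [this, hU, trace_mul_comm, Matrix.one_mul, Matrix.mul_one]
    have : Y * (diagonal (fun i => (α i : ℂ)) * (Yᴴ * Vᴴ)) * V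
      = Y * diagonal (fun i => (α i : ℂ)) * Yᴴ * (Vᴴ * V) := by simp only [Matrix.mul_assoc]
    rw [this, hV]
    simp
  have h1' : (trace (diagonal (fun i => (β i : ℂ)) * (Y * Gᴴ))).re
      = ∑ k, ∑ j, β k * ((β k / (t * α j + β k)) * Complex.normSq (G k j)) := by
    rw [aux_trace_diag]
    refine Finset.sum_congr rfl fun k _ => ?_
    rw [← Finset.mul_sum]
    congr 1
    rw [Matrix.mul_apply, Complex.re_sum]
    refine Finset.sum_congr rfl fun j _ => ?_
    rw [conjTranspose_apply, Complex.star_def]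
    change ((((β k / (t * α j + β k) : ℝ) : ℂ) * G k j) * _).re = _
    rw [mul_assoc, Complex.mul_conj, ← Complex.ofReal_mul, Complex.ofReal_re]
  rw [h1, h2, h3, h1', aux_trace_two, aux_trace_two]
  simp only [Finset.mul_sum, ← Finset.sum_sub_distrib]
  refine Finset.sum_congr rfl fun k _ => Finset.sum_congr rfl fun j _ => ?_
  have hY : Complex.normSq (Y k j)
      = (β k / (t * α j + β k)) ^ 2 * Complex.normSq (G k j) := by
    change Complex.normSq (((β k / (t * α j + β k) : ℝ) : ℂ) * G k j) = _
    rw [Complex.normSq_mul, Complex.normSq_ofReal, pow_two]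
  rw [hY]
  have hc : (t * α j + β k) * (β k / (t * α j + β k)) = β k := by
    have := hβ k
    have := hα j
    field_simp
  generalize β k / (t * α j + β k) = c at *
  generalize Complex.normSq (G k j) = g at *
  have : (t * α j + β k) * c * c * g = β k * c * g := by rw [hc]
  linarith

open Matrix MeasureTheory in
theorem aux_int {n : ℕ} (U V M : Matrix (Fin n) (Fin n) ℂ) (α β l : Fin n → ℝ)
    (hU : Uᴴ * U = 1) (hV : Vᴴ * V = 1)
    (hα : ∀ i, 0 < α i) (hβ : ∀ i, 0 ≤ β i) (hl : ∀ i, 0 ≤ l i)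
    (hA : U * diagonal (fun i => (α i : ℂ)) * Uᴴ = M * Mᴴ)
    (hB : V * diagonal (fun i => (β i : ℂ)) * Vᴴ = M * diagonal (fun i => (l i : ℂ)) * Mᴴ)
    (p : ℝ) (hp : p ∈ Set.Ioo (0 : ℝ) 1) :
    ∑ k, ∑ j, β k * Complex.normSq ((Vᴴ * U) k j) * (β k / α j) ^ p
      ≤ ∑ i, l i * ((Mᴴ * M) i i).re * (l i) ^ p := by
  have hx : ∀ k j, 0 ≤ β k / α j := fun k j => div_nonneg (hβ k) (hα j).le
  have hI : ∀ x : ℝ, 0 ≤ x → ∀ c : ℝ,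
      Integrable (fun t => c * Real.rpowIntegrand₀₁ p t x) (volume.restrict (Set.Ioi 0)) :=
    fun x hx c => (Real.integrableOn_rpowIntegrand₀₁_Ioi hp hx).const_mul c
  have hpos : 0 < ∫ t in Set.Ioi 0, Real.rpowIntegrand₀₁ p t 1 :=
    Real.integral_rpowIntegrand₀₁_one_pos hp
  have hmono : ∫ t in Set.Ioi (0 : ℝ), ∑ k, ∑ j, β k * Complex.normSq ((Vᴴ * U) k j)
        * Real.rpowIntegrand₀₁ p t (β k / α j)
      ≤ ∫ t in Set.Ioi (0 : ℝ), ∑ i, l i * ((Mᴴ * M) i i).re * Real.rpowIntegrand₀₁ p t (l i) := by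
    refine setIntegral_mono_on ?_ ?_ measurableSet_Ioi ?_
    · exact integrable_finsetSum _ fun k _ => integrable_finsetSum _ fun j _ => hI _ (hx k j) _
    · exact integrable_finsetSum _ fun i _ => hI _ (hl i) _
    · intro t ht
      have ht : 0 < t := ht
      have h := mul_le_mul_of_nonneg_left (aux_step_s15 U V M α β l hU hV hα hβ hl hA hB t ht)
        (Real.rpow_nonneg ht.le (p - 1))
      simp only [Finset.mul_sum] at h
      refine le_trans (le_of_eq ?_) (h.trans (le_of_eq ?_))
      · refine Finset.sum_congr rfl fun k _ => Finset.sum_congr rfl fun j _ => ?_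
        rw [Real.rpowIntegrand₀₁_eq_pow_div hp ht.le (hx k j)]
        have := hα j
        have := hβ k
        have e : t + β k / α j = (t * α j + β k) / α j := by field_simp
        rw [e]
        field_simp
      · refine Finset.sum_congr rfl fun i _ => ?_
        rw [Real.rpowIntegrand₀₁_eq_pow_div hp ht.le (hl i)]
        ring
  rw [integral_finsetSum _ fun k _ => integrable_finsetSum _ fun j _ => hI _ (hx k j) _,
    integral_finsetSum _ fun i _ => hI _ (hl i) _] at hmono
  simp only [integral_const_mul, Real.integral_rpowIntegrand₀₁_eq_rpow_mul_const hp (hl _)] at hmono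
  have e : ∀ k, ∫ t in Set.Ioi (0 : ℝ), ∑ j, β k * Complex.normSq ((Vᴴ * U) k j)
        * Real.rpowIntegrand₀₁ p t (β k / α j) = ∑ j, β k * Complex.normSq ((Vᴴ * U) k j)
        * ((β k / α j) ^ p * ∫ t in Set.Ioi 0, Real.rpowIntegrand₀₁ p t 1) := by
    intro k
    rw [integral_finsetSum _ fun j _ => hI _ (hx k j) _]
    simp only [integral_const_mul, Real.integral_rpowIntegrand₀₁_eq_rpow_mul_const hp (hx k _)]
  simp only [e, ← mul_assoc, ← Finset.sum_mul] at hmono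
  exact le_of_mul_le_mul_right hmono hpos

open Matrix in
theorem aux_spec {n : ℕ} (A : Matrix (Fin n) (Fin n) ℂ) (hA : A.IsHermitian) :
    ∃ U : Matrix (Fin n) (Fin n) ℂ, Uᴴ * U = 1 ∧ U * Uᴴ = 1 ∧
      (A = U * diagonal (fun i => (hA.eigenvalues i : ℂ)) * Uᴴ) ∧
      ∀ s : ℝ, mpow A s = U * diagonal (fun i => ((hA.eigenvalues i ^ s : ℝ) : ℂ)) * Uᴴ := by
  refine ⟨hA.eigenvectorUnitary, ?_, ?_, ?_, ?_⟩
  · exact Unitary.coe_star_mul_self hA.eigenvectorUnitary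
  · exact Unitary.coe_mul_star_self hA.eigenvectorUnitary
  · exact hA.spectral_theorem
  · intro s
    rw [mpow, hA.cfc_eq]
    rfl

open Matrix in
theorem aux_main {n : ℕ} (A B : Matrix (Fin n) (Fin n) ℂ)
    (hA : A.PosDef) (hB : B.PosSemidef)
    (s : ℝ) (hs : s ∈ Set.Icc (1 : ℝ) 2) :
    (Matrix.trace (mpow A (1 - s) * mpow B s)).re ≤
      (Matrix.trace (A * mpow (mpow A (-(1/2)) * B * mpow A (-(1/2))) s)).re := by
  obtain ⟨U, hU, hU', eA, pA⟩ := aux_spec A hA.1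
  obtain ⟨V, hV, hV', eB, pB⟩ := aux_spec B hB.1
  have hα : ∀ i, 0 < hA.1.eigenvalues i := hA.eigenvalues_pos
  have hβ : ∀ i, 0 ≤ hB.1.eigenvalues i := hB.eigenvalues_nonneg
  generalize hA.1.eigenvalues = α at *
  generalize hB.1.eigenvalues = β at *
  have hmul : ∀ r q : ℝ, mpow A r * mpow A q = mpow A (r + q) := by
    intro r q
    rw [pA, pA, pA]
    have : U * diagonal (fun i => ((α i ^ r : ℝ) : ℂ)) * Uᴴ
        * (U * diagonal (fun i => ((α i ^ q : ℝ) : ℂ)) * Uᴴ)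
      = U * (diagonal (fun i => ((α i ^ r : ℝ) : ℂ)) * ((Uᴴ * U) *
        diagonal (fun i => ((α i ^ q : ℝ) : ℂ)))) * Uᴴ := by simp only [Matrix.mul_assoc]
    rw [this, hU, Matrix.one_mul, diagonal_mul_diagonal]
    simp only [← Complex.ofReal_mul, ← Real.rpow_add (hα _)]
  have hzero : mpow A 0 = 1 := by
    rw [pA]; simp [hU']
  have hone : mpow A 1 = A := by
    rw [pA]; simp only [Real.rpow_one]; exact eA.symm
  have hherm : ∀ r, (mpow A r)ᴴ = mpow A r := by
    intro r
    rw [pA]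
    simp [Matrix.mul_assoc, diagonal_conjTranspose, Pi.star_def]
  set T := mpow A (-(1/2)) with hT
  set S := mpow A (1/2) with hS
  have hST : S * T = 1 := by rw [hS, hT, hmul, ← hzero]; norm_num
  have hTS : T * S = 1 := by rw [hS, hT, hmul, ← hzero]; norm_num
  have hSS : S * S = A := by
    rw [hS, hmul]
    conv_rhs => rw [← hone]
    norm_num
  have hC : (T * B * T).PosSemidef := by
    have := hB.conjTranspose_mul_mul_same T
    rwa [hT, hherm, ← hT] at this
  obtain ⟨W, hW, hW', eC, pC⟩ := aux_spec _ hC.1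
  have hl : ∀ i, 0 ≤ hC.1.eigenvalues i := hC.eigenvalues_nonneg
  generalize hC.1.eigenvalues = l at *
  have hMM : U * diagonal (fun i => (α i : ℂ)) * Uᴴ = (S * W) * (S * W)ᴴ := by
    rw [← eA, conjTranspose_mul, hS, hherm, ← hS]
    have : S * W * (Wᴴ * S) = S * (W * Wᴴ) * S := by simp only [Matrix.mul_assoc]
    rw [this, hW', Matrix.mul_one, hSS]
  have hML : V * diagonal (fun i => (β i : ℂ)) * Vᴴ
      = (S * W) * diagonal (fun i => (l i : ℂ)) * (S * W)ᴴ := by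
    rw [← eB, conjTranspose_mul, hS, hherm, ← hS]
    have : S * W * diagonal (fun i => (l i : ℂ)) * (Wᴴ * S)
      = S * (W * diagonal (fun i => (l i : ℂ)) * Wᴴ) * S := by simp only [Matrix.mul_assoc]
    rw [this, ← eC]
    have : S * (T * B * T) * S = (S * T) * B * (T * S) := by simp only [Matrix.mul_assoc]
    rw [this, hST, hTS, Matrix.one_mul, Matrix.mul_one]
  have hL : ∀ r : ℝ, (trace (mpow A (1 - r) * mpow B r)).re
      = ∑ k, ∑ j, β k ^ r * (α j ^ (1 - r) * Complex.normSq ((Vᴴ * U) k j)) := by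
    intro r
    rw [← aux_trace_two, pA, pB, conjTranspose_mul, conjTranspose_conjTranspose]
    rw [trace_mul_comm, Matrix.mul_assoc, Matrix.mul_assoc, trace_mul_comm]
    simp only [Matrix.mul_assoc]
  have hR : ∀ r : ℝ, (trace (A * mpow (T * B * T) r)).re
      = ∑ i, l i ^ r * (((S * W)ᴴ * (S * W)) i i).re := by
    intro r
    rw [← aux_trace_diag, pC, conjTranspose_mul, hS, hherm, ← hS]
    rw [trace_mul_comm, Matrix.mul_assoc, Matrix.mul_assoc, trace_mul_comm, ← hSS]
    simp only [Matrix.mul_assoc]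
  have hopen : ∀ r ∈ Set.Ioo (1 : ℝ) 2,
      ∑ k, ∑ j, β k ^ r * (α j ^ (1 - r) * Complex.normSq ((Vᴴ * U) k j))
        ≤ ∑ i, l i ^ r * (((S * W)ᴴ * (S * W)) i i).re := by
    intro r hr
    have h := aux_int U V (S * W) α β l hU hV hα hβ hl hMM hML (r - 1)
      ⟨by linarith [hr.1], by linarith [hr.2]⟩
    have hpow : ∀ x : ℝ, 0 ≤ x → x * x ^ (r - 1) = x ^ r := by
      intro x hx
      have h1 : (1 : ℝ) + (r - 1) ≠ 0 := by linarith [hr.1]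
      have := Real.rpow_add' hx h1
      rw [Real.rpow_one] at this
      rw [← this]; congr 1; ring
    refine le_trans (le_of_eq ?_) (h.trans (le_of_eq ?_))
    · refine Finset.sum_congr rfl fun k _ => Finset.sum_congr rfl fun j _ => ?_
      rw [Real.div_rpow (hβ k) (hα j).le, ← hpow _ (hβ k), div_eq_mul_inv,
        ← Real.rpow_neg (hα j).le, neg_sub]
      ring
    · refine Finset.sum_congr rfl fun i _ => ?_
      rw [← hpow _ (hl i)]
      ring
  rw [hL, hR]
  have hcl : closure (Set.Ioo (1 : ℝ) 2) = Set.Icc 1 2 := closure_Ioo (by norm_num)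
  have hcont : ∀ x : ℝ, ContinuousOn (fun r : ℝ => x ^ r) (Set.Icc 1 2) := by
    intro x r hr
    exact (Real.continuousAt_const_rpow' (by linarith [hr.1])).continuousWithinAt
  refine le_on_closure hopen ?_ ?_ (hcl ▸ hs)
  · rw [hcl]
    refine continuousOn_finsetSum _ fun k _ => continuousOn_finsetSum _ fun j _ => ?_
    refine (hcont _).mul (ContinuousOn.mul ?_ continuousOn_const)
    exact (Continuous.rpow continuous_const (by fun_prop)
      (fun _ => Or.inl (hα j).ne')).continuousOn
  · rw [hcl]
    refine continuousOn_finsetSum _ fun i _ => ?_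
    exact (hcont _).mul continuousOn_const

/-- Matharu–Aujla trace inequality (reversed direction): for `A` positive definite, `B` positive
semidefinite and `s ∈ [1,2]`:
`Tr[A^{1-s} B^s] ≤ Tr[A (A^{-1/2} B A^{-1/2})^s]` (as real parts). -/
theorem stmt_15 {n : ℕ} (A B : Matrix (Fin n) (Fin n) ℂ)
    (hA : A.PosDef) (hB : B.PosSemidef)
    (s : ℝ) (hs : s ∈ Set.Icc (1 : ℝ) 2) :
    (Matrix.trace (mpow A (1 - s) * mpow B s)).re ≤
      (Matrix.trace (A * mpow (mpow A (-(1/2)) * B * mpow A (-(1/2))) s)).re := by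
  exact aux_main A B hA hB s hs
end
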